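/- arXiv:1110.4155 — 5 statements merged into one kernel-verified Lean document; each statement's English description precedes it below -/
import Mathlib

section
/- (Well-definedness of the twisted Weyl-group sum, D(k+1,l)^(2).) Let Ŵ′ be the group of linear automorphisms of V generated by the reflections s_β(λ) = λ − (2(λ,β)/(β,β))·β for β ∈ {sδ±ε_i : s∈ℤ, 1≤i≤k} ∪ {2sδ±ε_i±ε_j : s∈ℤ, 1≤i<j≤k}, and let S = {ε₁−δ₁, …, ε_l−δ_l}. Then: (i) for every w ∈ Ŵ′ one has wβ ∈ Δ̂ for all β∈S, and ρ̂ − w(ρ̂) − Σ_{β∈S with wβ∉Δ̂⁺} w(β) ∈ Q̂⁺; (ii) for every r ∈ ℕ, the set of w ∈ Ŵ′ such that ht(ρ̂ − w(ρ̂) − Σ_{β∈S with wβ∉Δ̂⁺} w(β)) ≤ r is finite, where ht(Σ_{α∈π̂} n_α·α) := Σ_{α∈π̂} n_α. -/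
/-!
Well-definedness of the twisted Weyl-group sum for `D(k+1,l)^(2)`:
for the group `Ŵ′` generated by the reflections in the roots
`{sδ±ε_i} ∪ {2sδ±ε_i±ε_j (i<j)}` and `S = {ε₁−δ₁, …, ε_l−δ_l}`, one has
(i) for every `w ∈ Ŵ′`, `wβ ∈ Δ̂` for all `β ∈ S` and
`ρ̂ − w(ρ̂) − Σ_{β∈S, wβ∉Δ̂⁺} w(β) ∈ Q̂⁺`;
(ii) for every `r ∈ ℕ` the set of `w ∈ Ŵ′` with
`ht(ρ̂ − w(ρ̂) − Σ_{β∈S, wβ∉Δ̂⁺} w(β)) ≤ r` is finite.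
-/

open scoped BigOperators Classical

noncomputable section

namespace Stmt9

variable (k l : ℕ)

/-- Weight space, with basis `ε₁,…,ε_k, δ₁,…,δ_l, δ, Λ₀`. -/
abbrev V : Type := (Fin k → ℚ) × (Fin l → ℚ) × ℚ × ℚ

/-- `ε_{m+1}` (0-indexed: `epsN m`). -/
def epsN (m : ℕ) : V k l := (fun i => if (i : ℕ) = m then 1 else 0, 0, 0, 0)

/-- `δ_{m+1}` (0-indexed: `dlN m`). -/
def dlN (m : ℕ) : V k l := (0, fun g => if (g : ℕ) = m then 1 else 0, 0, 0)

/-- the minimal imaginary root `δ`. -/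
def dd : V k l := (0, 0, 1, 0)

/-- `Λ₀`. -/
def lam : V k l := (0, 0, 0, 1)

/-- The bilinear form: `(ε_i,ε_j)=δ_{ij}`, `(δ_g,δ_h)=−δ_{gh}`, `(ε_i,δ_g)=0`,
`δ,Λ₀` isotropic and orthogonal to all `ε_i, δ_g`, `(δ,Λ₀)=1`. -/
def form (x y : V k l) : ℚ :=
  (∑ i, x.1 i * y.1 i) - (∑ g, x.2.1 g * y.2.1 g) + x.2.2.1 * y.2.2.2 + x.2.2.2 * y.2.2.1

/-- sign attached to a boolean -/
def sg (b : Bool) : ℚ := cond b 1 (-1)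

/-- The set `Δ̂` of roots of `D(k+1,l)^(2)`:
even roots `2sδ±ε_i±ε_j (i<j)`, `sδ±ε_i`, `2sδ±δ_g±δ_h (g<h)`, `2sδ±2δ_g`,
`sδ (s≠0)`; odd roots `2sδ±ε_i±δ_g`, `sδ±δ_g`. -/
def DeltaHat : Set (V k l) :=
  {v | ∃ s : ℤ, ∃ b₁ b₂ : Bool, ∃ i j : Fin k, (i : ℕ) < (j : ℕ) ∧
      v = ((2 * s : ℤ) : ℚ) • dd k l + sg b₁ • epsN k l i + sg b₂ • epsN k l j} ∪
  {v | ∃ s : ℤ, ∃ b : Bool, ∃ i : Fin k, v = (s : ℚ) • dd k l + sg b • epsN k l i} ∪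
  {v | ∃ s : ℤ, ∃ b₁ b₂ : Bool, ∃ g h : Fin l, (g : ℕ) < (h : ℕ) ∧
      v = ((2 * s : ℤ) : ℚ) • dd k l + sg b₁ • dlN k l g + sg b₂ • dlN k l h} ∪
  {v | ∃ s : ℤ, ∃ b : Bool, ∃ g : Fin l,
      v = ((2 * s : ℤ) : ℚ) • dd k l + (2 * sg b) • dlN k l g} ∪
  {v | ∃ s : ℤ, s ≠ 0 ∧ v = (s : ℚ) • dd k l} ∪
  {v | ∃ s : ℤ, ∃ b₁ b₂ : Bool, ∃ i : Fin k, ∃ g : Fin l,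
      v = ((2 * s : ℤ) : ℚ) • dd k l + sg b₁ • epsN k l i + sg b₂ • dlN k l g} ∪
  {v | ∃ s : ℤ, ∃ b : Bool, ∃ g : Fin l, v = (s : ℚ) • dd k l + sg b • dlN k l g}

/-- The simple roots `π = {ε₁−δ₁, δ₁−ε₂, …, ε_l−δ_l, δ_l−ε_{l+1},
ε_{l+1}−ε_{l+2}, …, ε_{k−1}−ε_k, ε_k}` of the finite part. -/
def piSet : Set (V k l) :=
  {v | ∃ m : ℕ, m + 1 ≤ l ∧ v = epsN k l m - dlN k l m} ∪
  {v | ∃ m : ℕ, m + 1 ≤ l ∧ v = dlN k l m - epsN k l (m + 1)} ∪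
  {v | ∃ m : ℕ, l ≤ m ∧ m + 2 ≤ k ∧ v = epsN k l m - epsN k l (m + 1)} ∪
  {v | v = epsN k l (k - 1)}

/-- `π̂ = {δ − ε₁} ∪ π`, a linearly independent set. -/
def piHatSet : Set (V k l) := insert (dd k l - epsN k l 0) (piSet k l)

/-- `Q̂⁺`, the ℕ-span of `π̂`. -/
def Qp : AddSubmonoid (V k l) := AddSubmonoid.closure (piHatSet k l)

/-- `Δ̂⁺ = Δ̂ ∩ (ℕπ̂∖{0})`. -/
def DeltaHatPos : Set (V k l) := {v | v ∈ DeltaHat k l ∧ v ∈ Qp k l ∧ v ≠ 0}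

/-- The set of reflecting roots
`{sδ±ε_i : s∈ℤ, 1≤i≤k} ∪ {2sδ±ε_i±ε_j : s∈ℤ, 1≤i<j≤k}`. -/
def Bset : Set (V k l) :=
  {v | ∃ s : ℤ, ∃ b : Bool, ∃ i : Fin k, v = (s : ℚ) • dd k l + sg b • epsN k l i} ∪
  {v | ∃ s : ℤ, ∃ b₁ b₂ : Bool, ∃ i j : Fin k, (i : ℕ) < (j : ℕ) ∧
      v = ((2 * s : ℤ) : ℚ) • dd k l + sg b₁ • epsN k l i + sg b₂ • epsN k l j}

/-- `Ŵ′`, the group of linear automorphisms of `V` generated by the reflections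
`s_β(λ) = λ − (2(λ,β)/(β,β))·β` for `β ∈ Bset`. -/
def Wp : Subgroup (V k l ≃ₗ[ℚ] V k l) :=
  Subgroup.closure
    {w | ∃ β ∈ Bset k l, ∀ v : V k l, w v = v - (2 * form k l v β / form k l β β) • β}

/-- `S = {ε₁−δ₁, …, ε_l−δ_l}` (as a family indexed by `Fin l`). -/
def Sv (g : Fin l) : V k l := epsN k l g - dlN k l g

/-- `ρ̂ − w(ρ̂) − Σ_{β∈S, wβ∉Δ̂⁺} w(β)`. -/
def defect (ρ : V k l) (w : V k l ≃ₗ[ℚ] V k l) : V k l :=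
  ρ - w ρ - ∑ g : Fin l, (if w (Sv k l g) ∈ DeltaHatPos k l then 0 else w (Sv k l g))

section Auxiliary

variable {k l}

/-- The affine signed permutation with linear part the signed permutation `(τ, σ)` and
translation part `2m`. -/
def affineAct (τ : Equiv.Perm (Fin k)) (σ : Fin k → ℤˣ) (m : Fin k → ℤ) (v : V k l) : V k l :=
  (fun p => ((σ p : ℤ) : ℚ) * v.1 (τ p) + 2 * (m p : ℚ) * v.2.2.2, v.2.1,
    v.2.2.1 - ∑ p, (2 * ((σ p : ℤ) : ℚ) * (m p : ℚ) * v.1 (τ p) + 2 * (m p : ℚ) ^ 2 * v.2.2.2),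
    v.2.2.2)

lemma unit_cast_sq (u : ℤˣ) : ((u : ℤ) : ℚ) * ((u : ℤ) : ℚ) = 1 := by
  rcases Int.units_eq_one_or u with h | h <;> simp [h]

lemma affineAct_comp (τ τ' : Equiv.Perm (Fin k)) (σ σ' : Fin k → ℤˣ) (m m' : Fin k → ℤ)
    (v : V k l) :
    affineAct τ σ m (affineAct τ' σ' m' v) =
      affineAct (τ.trans τ') (fun p => σ p * σ' (τ p)) (fun p => (σ p : ℤ) * m' (τ p) + m p) v := by
  refine Prod.ext ?_ (Prod.ext rfl (Prod.ext ?_ rfl))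
  · funext p
    simp only [affineAct, Equiv.trans_apply]
    push_cast
    ring
  · simp only [affineAct, Equiv.trans_apply]
    rw [← Equiv.sum_comp τ (fun q => 2 * ((σ' q : ℤ) : ℚ) * (m' q : ℚ) * v.1 (τ' q) +
      2 * (m' q : ℚ) ^ 2 * v.2.2.2), sub_sub, ← Finset.sum_add_distrib]
    congr 1
    refine Finset.sum_congr rfl fun p _ => ?_
    push_cast
    linear_combination (-2 * ((σ' (τ p) : ℤ) : ℚ) * (m' (τ p) : ℚ) * v.1 (τ' (τ p))
      - 2 * (m' (τ p) : ℚ) ^ 2 * v.2.2.2) * unit_cast_sq (σ p)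

lemma affineAct_one (v : V k l) : affineAct 1 1 0 v = v := by
  refine Prod.ext ?_ (Prod.ext rfl (Prod.ext ?_ rfl)) <;> simp [affineAct]

lemma affineAct_right_inv (τ : Equiv.Perm (Fin k)) (σ : Fin k → ℤˣ) (m : Fin k → ℤ) (v : V k l) :
    affineAct τ σ m (affineAct τ.symm (fun q => σ (τ.symm q))
      (fun q => -((σ (τ.symm q) : ℤ) * m (τ.symm q))) v) = v := by
  rw [affineAct_comp]
  conv_rhs => rw [← affineAct_one v]
  congr 1
  · ext p; simp
  · funext p; simp
  · funext p
    rcases Int.units_eq_one_or (σ p) with h | h <;> simp [h]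

/-- The unit attached to a boolean sign. -/
def signUnit (b : Bool) : ℤˣ := cond b 1 (-1)

lemma signUnit_cast (b : Bool) : ((signUnit b : ℤ) : ℚ) = sg b := by
  cases b <;> simp [signUnit, sg]

lemma sg_mul_self (b : Bool) : sg b * sg b = 1 := by cases b <;> simp [sg]

lemma reflection_short (s : ℤ) (b : Bool) (i : Fin k) (v : V k l) :
    v - (2 * form k l v ((s : ℚ) • dd k l + sg b • epsN k l i) /
      form k l ((s : ℚ) • dd k l + sg b • epsN k l i) ((s : ℚ) • dd k l + sg b • epsN k l i)) •
        ((s : ℚ) • dd k l + sg b • epsN k l i) =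
    affineAct 1 (fun p => if p = i then -1 else 1)
      (fun p => if p = i then -((signUnit b : ℤ) * s) else 0) v := by
  have h1 : form k l v ((s : ℚ) • dd k l + sg b • epsN k l i) = sg b * v.1 i + s * v.2.2.2 := by
    simp [form, dd, epsN, Fin.val_inj]; ring
  have h2 : form k l ((s : ℚ) • dd k l + sg b • epsN k l i)
      ((s : ℚ) • dd k l + sg b • epsN k l i) = 1 := by
    simp [form, dd, epsN, Fin.val_inj, sg_mul_self]
  rw [h1, h2]
  have hb := sg_mul_self b
  refine Prod.ext ?_ (Prod.ext ?_ (Prod.ext ?_ ?_))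
  · funext p
    by_cases hp : p = i
    · subst hp
      simp [affineAct, dd, epsN, signUnit_cast]
      linear_combination (-2 * v.1 p) * hb
    · simp [affineAct, dd, epsN, hp, Fin.val_inj]
  · simp [affineAct, dd, epsN]
  · simp only [affineAct]
    rw [Finset.sum_eq_single i (by intro p _ hp; simp [hp]) (by simp)]
    simp [dd, epsN, signUnit_cast]
    linear_combination (-2 * s ^ 2 * v.2.2.2) * hb
  · simp [affineAct, dd, epsN]

lemma reflection_long (s : ℤ) (b₁ b₂ : Bool) (i j : Fin k) (hij : i ≠ j) (v : V k l) :
    v - (2 * form k l v (((2 * s : ℤ) : ℚ) • dd k l + sg b₁ • epsN k l i + sg b₂ • epsN k l j) /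
      form k l (((2 * s : ℤ) : ℚ) • dd k l + sg b₁ • epsN k l i + sg b₂ • epsN k l j)
        (((2 * s : ℤ) : ℚ) • dd k l + sg b₁ • epsN k l i + sg b₂ • epsN k l j)) •
        (((2 * s : ℤ) : ℚ) • dd k l + sg b₁ • epsN k l i + sg b₂ • epsN k l j) =
    affineAct (Equiv.swap i j)
      (fun p => if p = i ∨ p = j then -(signUnit b₁ * signUnit b₂) else 1)
      (fun p => if p = i then -((signUnit b₁ : ℤ) * s)
        else if p = j then -((signUnit b₂ : ℤ) * s) else 0) v := by
  have hji := hij.symm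
  have h1 : form k l v (((2 * s : ℤ) : ℚ) • dd k l + sg b₁ • epsN k l i + sg b₂ • epsN k l j) =
      sg b₁ * v.1 i + sg b₂ * v.1 j + 2 * s * v.2.2.2 := by
    simp [form, dd, epsN, Fin.val_inj, mul_add, Finset.sum_add_distrib]; ring
  have hb₁ := sg_mul_self b₁
  have hb₂ := sg_mul_self b₂
  have h2 : form k l (((2 * s : ℤ) : ℚ) • dd k l + sg b₁ • epsN k l i + sg b₂ • epsN k l j)
      (((2 * s : ℤ) : ℚ) • dd k l + sg b₁ • epsN k l i + sg b₂ • epsN k l j) = 2 := by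
    simp [form, dd, epsN, Fin.val_inj, mul_add, Finset.sum_add_distrib, hij, hji]
    linear_combination hb₁ + hb₂
  rw [h1, h2]
  refine Prod.ext ?_ (Prod.ext ?_ (Prod.ext ?_ ?_))
  · funext p
    by_cases hp : p = i
    · subst hp
      simp [affineAct, dd, epsN, signUnit_cast, Fin.val_inj, hij]
      linear_combination (-v.1 p) * hb₁
    · by_cases hp' : p = j
      · subst hp'
        simp [affineAct, dd, epsN, signUnit_cast, Fin.val_inj, hp]
        linear_combination (-v.1 p) * hb₂
      · simp [affineAct, dd, epsN, hp, hp', Fin.val_inj, Equiv.swap_apply_of_ne_of_ne hp hp']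
  · simp [affineAct, dd, epsN]
  · simp only [affineAct]
    rw [Finset.sum_eq_add i j hij (by rintro p _ ⟨h, h'⟩; simp [h, h']) (by simp) (by simp)]
    simp [dd, epsN, signUnit_cast, hji]
    linear_combination -(2 * s ^ 2 * v.2.2.2 + 2 * sg b₂ * s * v.1 j) * hb₁ -
      (2 * s ^ 2 * v.2.2.2 + 2 * sg b₁ * s * v.1 i) * hb₂
  · simp [affineAct, dd, epsN]

lemma exists_affineAct_of_mem_Wp {w : V k l ≃ₗ[ℚ] V k l} (hw : w ∈ Wp k l) :
    ∃ τ σ m, ∀ v, w v = affineAct τ σ m v := by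
  induction hw using Subgroup.closure_induction with
  | mem w h =>
    obtain ⟨β, hβ, hw⟩ := h
    rcases hβ with ⟨s, b, i, rfl⟩ | ⟨s, b₁, b₂, i, j, hij, rfl⟩
    · exact ⟨_, _, _, fun v => (hw v).trans (reflection_short s b i v)⟩
    · exact ⟨_, _, _, fun v => (hw v).trans
        (reflection_long s b₁ b₂ i j (fun h => hij.ne (congrArg Fin.val h)) v)⟩
  | one => exact ⟨1, 1, 0, fun v => (affineAct_one v).symm⟩
  | mul x y _ _ hx hy =>
    obtain ⟨τ, σ, m, hx⟩ := hx
    obtain ⟨τ', σ', m', hy⟩ := hy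
    exact ⟨_, _, _, fun v => by rw [LinearEquiv.mul_apply, hy, hx, affineAct_comp]⟩
  | inv x _ hx =>
    obtain ⟨τ, σ, m, hx⟩ := hx
    refine ⟨τ.symm, fun q => σ (τ.symm q), fun q => -((σ (τ.symm q) : ℤ) * m (τ.symm q)),
      fun v => x.injective ?_⟩
    rw [hx (affineAct _ _ _ v), affineAct_right_inv]
    exact x.apply_symm_apply v

/-- The coefficient of `δ` plus the first `n` coefficients of the `ε_i` and the first `n'`
coefficients of the `δ_g`. -/
def prefixSum (v : V k l) (n n' : ℕ) : ℚ :=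
  v.2.2.1 + (∑ p : Fin k, if (p : ℕ) < n then v.1 p else 0) +
    ∑ g : Fin l, if (g : ℕ) < n' then v.2.1 g else 0

/-- The part of `v` supported on `δ` and the first `n` of the `ε_i` and of the `δ_g`. -/
def truncate (v : V k l) (n : ℕ) : V k l :=
  (fun p => if (p : ℕ) < n then v.1 p else 0, fun g => if (g : ℕ) < n then v.2.1 g else 0,
    v.2.2.1, 0)

lemma sum_lt_succ {N : ℕ} (f : Fin N → ℚ) (n : ℕ) :
    (∑ p : Fin N, if (p : ℕ) < n + 1 then f p else 0) =
      (∑ p : Fin N, if (p : ℕ) < n then f p else 0) +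
        ∑ p : Fin N, if (p : ℕ) = n then f p else 0 := by
  rw [← Finset.sum_add_distrib]
  refine Finset.sum_congr rfl fun p _ => ?_
  rcases lt_trichotomy (p : ℕ) n with h | h | h
  · simp [h, h.ne, Nat.lt_succ_of_lt h]
  · simp [h]
  · simp [h.ne', not_lt_of_gt h, show ¬ (p : ℕ) < n + 1 by omega]

lemma ite_lt_succ {N : ℕ} (f : Fin N → ℚ) (n : ℕ) (p : Fin N) :
    (if (p : ℕ) < n + 1 then f p else 0) = (if (p : ℕ) < n then f p else 0) +
      (∑ q : Fin N, if (q : ℕ) = n then f q else 0) * (if (p : ℕ) = n then 1 else 0) := by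
  rcases lt_trichotomy (p : ℕ) n with h | h | h
  · simp [h, h.ne, Nat.lt_succ_of_lt h]
  · subst h
    simp [Fin.val_inj]
  · simp [h.ne', not_lt_of_gt h, show ¬ (p : ℕ) < n + 1 by omega]

lemma dlN_eq_zero {m : ℕ} (h : l ≤ m) : dlN k l m = 0 := by
  refine Prod.ext rfl (Prod.ext ?_ rfl)
  funext g
  simp [dlN, (lt_of_lt_of_le g.2 h).ne]

lemma epsN_eq_zero {m : ℕ} (h : k ≤ m) : epsN k l m = 0 := by
  refine Prod.ext ?_ rfl
  funext p
  simp [epsN, (lt_of_lt_of_le p.2 h).ne]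

lemma truncate_succ (v : V k l) (n : ℕ) :
    truncate v (n + 1) - prefixSum v (n + 1) (n + 1) • epsN k l (n + 1) =
      (truncate v n - prefixSum v n n • epsN k l n) +
      (prefixSum v (n + 1) n • (epsN k l n - dlN k l n) +
        prefixSum v (n + 1) (n + 1) • (dlN k l n - epsN k l (n + 1))) := by
  have h1 : prefixSum v (n + 1) n = prefixSum v n n +
      ∑ p : Fin k, if (p : ℕ) = n then v.1 p else 0 := by
    simp only [prefixSum, sum_lt_succ]; ring
  have h2 : prefixSum v (n + 1) (n + 1) = prefixSum v (n + 1) n +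
      ∑ p : Fin l, if (p : ℕ) = n then v.2.1 p else 0 := by
    simp only [prefixSum, sum_lt_succ v.2.1]; ring
  have h3 : truncate v (n + 1) = truncate v n +
      (∑ p : Fin k, if (p : ℕ) = n then v.1 p else 0) • epsN k l n +
      (∑ p : Fin l, if (p : ℕ) = n then v.2.1 p else 0) • dlN k l n := by
    refine Prod.ext ?_ (Prod.ext ?_ (Prod.ext ?_ ?_))
    · funext p
      simp only [truncate, epsN, dlN, ite_lt_succ v.1]; simp
    · funext p
      simp only [truncate, epsN, dlN, ite_lt_succ v.2.1]; simp
    · simp [truncate, epsN, dlN]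
    · simp [truncate, epsN, dlN]
  rw [h3, h2, h1]
  module

lemma smul_mem_Qp {q : ℚ} {z : ℤ} (hz : q = z) (h0 : 0 ≤ q) {α : V k l} (h : α ∈ Qp k l) :
    q • α ∈ Qp k l := by
  have hz0 : 0 ≤ z := by rw [hz] at h0; exact_mod_cast h0
  lift z to ℕ using hz0
  have : q • α = z • α := by rw [hz]; simp [Nat.cast_smul_eq_nsmul]
  rw [this]
  exact AddSubmonoid.nsmul_mem _ h _

lemma sub_mem_Qp_of_prefixSum_nonneg (hkl : l + 1 ≤ k) {v : V k l}
    (hx : ∀ p, ∃ a : ℤ, v.1 p = a) (hy : ∀ g, ∃ a : ℤ, v.2.1 g = a) (hz : ∃ a : ℤ, v.2.2.1 = a)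
    (ht : v.2.2.2 = 0) (h : ∀ n n', n' ≤ n → n ≤ n' + 1 → 0 ≤ prefixSum v n n') :
    v - v.2.2.1 • (dd k l - epsN k l 0) ∈ Qp k l := by
  have hint : ∀ n n', ∃ a : ℤ, prefixSum v n n' = a := by
    choose x hx using hx
    choose y hy using hy
    obtain ⟨z, hz⟩ := hz
    intro n n'
    refine ⟨z + (∑ p : Fin k, if (p : ℕ) < n then x p else 0) +
      ∑ g : Fin l, if (g : ℕ) < n' then y g else 0, ?_⟩
    simp [prefixSum, hx, hy, hz]
  have key : ∀ n, n ≤ k →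
      truncate v n - prefixSum v n n • epsN k l n - v.2.2.1 • (dd k l - epsN k l 0) ∈ Qp k l := by
    intro n
    induction n with
    | zero =>
      intro _
      have h0 : truncate v 0 = v.2.2.1 • dd k l := by
        refine Prod.ext ?_ (Prod.ext ?_ (Prod.ext ?_ ?_)) <;>
          simp [truncate, dd] <;> rfl
      have h1 : prefixSum v 0 0 = v.2.2.1 := by simp [prefixSum]
      rw [h0, h1, smul_sub, sub_self]
      exact zero_mem _
    | succ n ih =>
      intro hn
      rw [truncate_succ, add_sub_right_comm]
      refine add_mem (ih (by omega)) ?_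
      obtain ⟨a, ha⟩ := hint (n + 1) n
      obtain ⟨b, hb⟩ := hint (n + 1) (n + 1)
      have ha0 := h (n + 1) n (by omega) le_rfl
      have hb0 := h (n + 1) (n + 1) le_rfl (by omega)
      by_cases hnl : n < l
      · refine add_mem (smul_mem_Qp ha ha0 (AddSubmonoid.subset_closure ?_))
          (smul_mem_Qp hb hb0 (AddSubmonoid.subset_closure ?_))
        · exact Or.inr (Or.inl (Or.inl (Or.inl ⟨n, hnl, rfl⟩)))
        · exact Or.inr (Or.inl (Or.inl (Or.inr ⟨n, hnl, rfl⟩)))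
      · have hab : prefixSum v (n + 1) (n + 1) = prefixSum v (n + 1) n := by
          simp only [prefixSum, sum_lt_succ v.2.1]
          rw [Finset.sum_eq_zero (s := Finset.univ)
            (f := fun p : Fin l => if (p : ℕ) = n then v.2.1 p else 0), add_zero]
          intro g _
          rw [if_neg]
          have := g.2
          omega
        rw [hab, ← smul_add, dlN_eq_zero (by omega), sub_zero, zero_sub, ← sub_eq_add_neg]
        refine smul_mem_Qp ha ha0 (AddSubmonoid.subset_closure ?_)
        by_cases hnk : n + 1 < k
        · exact Or.inr (Or.inl (Or.inr ⟨n, by omega, by omega, rfl⟩))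
        · refine Or.inr (Or.inr ?_)
          rw [Set.mem_ofPred_eq, epsN_eq_zero (by omega : k ≤ n + 1), sub_zero,
            show n = k - 1 by omega]
  have hk := key k le_rfl
  have htr : truncate v k = v := by
    refine Prod.ext ?_ (Prod.ext ?_ (Prod.ext rfl ht.symm))
    · funext p; simp [truncate]
    · funext g; simp [truncate, show (g : ℕ) < k by have := g.2; omega]
  rwa [htr, epsN_eq_zero le_rfl, smul_zero, sub_zero] at hk

lemma mem_Qp_of_prefixSum_nonneg (hkl : l + 1 ≤ k) {v : V k l}
    (hx : ∀ p, ∃ a : ℤ, v.1 p = a) (hy : ∀ g, ∃ a : ℤ, v.2.1 g = a) (hz : ∃ a : ℤ, v.2.2.1 = a)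
    (ht : v.2.2.2 = 0) (h : ∀ n n', n' ≤ n → n ≤ n' + 1 → 0 ≤ prefixSum v n n') :
    v ∈ Qp k l := by
  have h1 := sub_mem_Qp_of_prefixSum_nonneg hkl hx hy hz ht h
  have h0 : 0 ≤ v.2.2.1 := by simpa [prefixSum] using h 0 0 le_rfl (by omega)
  obtain ⟨z, hz⟩ := hz
  have h2 : v.2.2.1 • (dd k l - epsN k l 0) ∈ Qp k l :=
    smul_mem_Qp hz h0 (AddSubmonoid.subset_closure (Or.inl rfl))
  simpa using add_mem h1 h2

lemma height_nonneg {ht : V k l →ₗ[ℚ] ℚ} (hht : ∀ α ∈ piHatSet k l, ht α = 1) {v : V k l}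
    (hv : v ∈ Qp k l) : 0 ≤ ht v := by
  induction hv using AddSubmonoid.closure_induction with
  | mem x hx => rw [hht x hx]; exact zero_le_one
  | zero => simp
  | add x y _ _ hx hy => rw [map_add]; exact add_nonneg hx hy

lemma affineAct_Sv (τ : Equiv.Perm (Fin k)) (σ : Fin k → ℤˣ) (m : Fin k → ℤ)
    (q : Fin k) (hq : (τ q : ℕ) < l) :
    affineAct τ σ m (Sv k l ⟨τ q, hq⟩) =
      ((2 * (-((σ q : ℤ) * m q)) : ℤ) : ℚ) • dd k l + ((σ q : ℤ) : ℚ) • epsN k l q +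
        (-1 : ℚ) • dlN k l (τ q) := by
  refine Prod.ext ?_ (Prod.ext ?_ (Prod.ext ?_ ?_))
  · funext p
    by_cases hp : p = q
    · subst hp; simp [affineAct, Sv, epsN, dlN, dd]
    · simp [affineAct, Sv, epsN, dlN, dd, Fin.val_inj, hp]
  · funext g; simp [affineAct, Sv, epsN, dlN, dd]
  · simp [affineAct, Sv, epsN, dlN, dd, Fin.val_inj]; ring
  · simp [affineAct, Sv, epsN, dlN, dd]

lemma affineAct_Sv_mem_DeltaHat (τ : Equiv.Perm (Fin k)) (σ : Fin k → ℤˣ)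
    (m : Fin k → ℤ) (q : Fin k) (hq : (τ q : ℕ) < l) :
    affineAct τ σ m (Sv k l ⟨τ q, hq⟩) ∈ DeltaHat k l := by
  rw [affineAct_Sv]
  refine Or.inl (Or.inr ⟨-((σ q : ℤ) * m q), decide (σ q = 1), false, q, ⟨τ q, hq⟩, ?_⟩)
  rcases Int.units_eq_one_or (σ q) with h | h <;> simp [h, sg]

lemma affineAct_Sv_mem_DeltaHatPos (hkl : l + 1 ≤ k) (τ : Equiv.Perm (Fin k)) (σ : Fin k → ℤˣ)
    (m : Fin k → ℤ) (q : Fin k) (hq : (τ q : ℕ) < l)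
    (h : (σ q : ℤ) * m q < 0 ∨ m q = 0 ∧ σ q = 1 ∧ q ≤ τ q) :
    affineAct τ σ m (Sv k l ⟨τ q, hq⟩) ∈ DeltaHatPos k l := by
  refine ⟨affineAct_Sv_mem_DeltaHat τ σ m q hq, ?_, ?_⟩
  · rw [affineAct_Sv]
    refine mem_Qp_of_prefixSum_nonneg hkl ?_ ?_ ?_ ?_ ?_
    · intro p
      by_cases hp : p = q
      · exact ⟨σ q, by simp [hp, epsN, dlN, dd]⟩
      · exact ⟨0, by simp [Fin.val_inj, hp, epsN, dlN, dd]⟩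
    · intro g
      by_cases hg : (g : ℕ) = τ q
      · exact ⟨-1, by simp [hg, epsN, dlN, dd]⟩
      · exact ⟨0, by simp [hg, epsN, dlN, dd]⟩
    · exact ⟨2 * (-((σ q : ℤ) * m q)), by simp [epsN, dlN, dd]⟩
    · simp [epsN, dlN, dd]
    · intro n n' h1 h2
      have hsum : prefixSum (((2 * (-((σ q : ℤ) * m q)) : ℤ) : ℚ) • dd k l +
          ((σ q : ℤ) : ℚ) • epsN k l q + (-1 : ℚ) • dlN k l (τ q)) n n' =
          ((2 * (-((σ q : ℤ) * m q)) + (if (q : ℕ) < n then (σ q : ℤ) else 0) -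
            (if (τ q : ℕ) < n' then 1 else 0) : ℤ) : ℚ) := by
        have e1 : ∀ p : Fin k, (if (p : ℕ) < n then (if p = q then ((σ q : ℤ) : ℚ) else 0) else 0) =
            if p = q then (if (q : ℕ) < n then ((σ q : ℤ) : ℚ) else 0) else 0 := by
          intro p; by_cases hp : p = q <;> simp [hp]
        have e2 : ∀ g : Fin l, (if (g : ℕ) < n' then
            -(if (g : ℕ) = τ q then (1 : ℚ) else 0) else 0) =
            if g = ⟨τ q, hq⟩ then -(if (τ q : ℕ) < n' then (1 : ℚ) else 0) else 0 := by
          intro g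
          by_cases hg : g = ⟨τ q, hq⟩
          · subst hg; simp only [if_true]; split_ifs <;> simp
          · have : (g : ℕ) ≠ τ q := fun h => hg (Fin.ext h)
            simp [hg, this]
        simp [prefixSum, epsN, dlN, dd, Fin.val_inj, e1, e2]
        ring
      rw [hsum]
      have hqτ : q ≤ τ q ↔ (q : ℕ) ≤ (τ q : ℕ) := Fin.le_def
      rw [hqτ] at h
      norm_cast
      rcases h with h | ⟨hm, hσ, hle⟩
      · rcases Int.units_eq_one_or (σ q) with hs | hs <;> simp only [hs] at h ⊢ <;>
          push_cast at h ⊢ <;> split_ifs <;> omega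
      · simp only [hm, hσ]
        push_cast
        split_ifs <;> omega
  · rw [affineAct_Sv]
    intro h0
    have := congrFun (congrArg (fun v : V k l => v.2.1) h0) ⟨τ q, hq⟩
    simp [epsN, dlN, dd] at this

lemma rho_coordinates (hl : 1 ≤ l) (hkl : l + 1 ≤ k) {ρ : V k l}
    (hρ : ∀ α ∈ piHatSet k l, form k l ρ α = form k l α α / 2) :
    (∀ p : Fin k, ρ.1 p = (k : ℚ) - (max (p : ℕ) l : ℕ) - 1 / 2) ∧ ρ.2.2.2 = (k : ℚ) - l := by
  have hfirst : ρ.2.2.2 - ρ.1 ⟨0, by omega⟩ = 1 / 2 := by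
    have := hρ _ (Or.inl rfl)
    have e : ∀ p : Fin k, (p : ℕ) = 0 ↔ p = ⟨0, by omega⟩ := fun p => by simp [Fin.ext_iff]
    simp [form, dd, epsN, e] at this
    linarith
  have hodd : ∀ m (h : m < l), ρ.1 ⟨m, by omega⟩ + ρ.2.1 ⟨m, h⟩ = 0 := by
    intro m h
    have := hρ _ (Or.inr (Or.inl (Or.inl (Or.inl ⟨m, h, rfl⟩))))
    have e : ∀ p : Fin k, (p : ℕ) = m ↔ p = ⟨m, by omega⟩ := fun p => by simp [Fin.ext_iff]
    have e' : ∀ p : Fin l, (p : ℕ) = m ↔ p = ⟨m, by omega⟩ := fun p => by simp [Fin.ext_iff]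
    simp [form, dlN, epsN, e, e'] at this
    linarith
  have hodd' : ∀ m (h : m < l), ρ.2.1 ⟨m, h⟩ + ρ.1 ⟨m + 1, by omega⟩ = 0 := by
    intro m h
    have := hρ _ (Or.inr (Or.inl (Or.inl (Or.inr ⟨m, h, rfl⟩))))
    have e : ∀ p : Fin k, (p : ℕ) = m + 1 ↔ p = ⟨m + 1, by omega⟩ :=
      fun p => by simp [Fin.ext_iff]
    have e' : ∀ p : Fin l, (p : ℕ) = m ↔ p = ⟨m, by omega⟩ := fun p => by simp [Fin.ext_iff]
    simp [form, dlN, epsN, e, e'] at this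
    linarith
  have heven : ∀ m (_ : l ≤ m) (h : m + 2 ≤ k),
      ρ.1 ⟨m, by omega⟩ - ρ.1 ⟨m + 1, by omega⟩ = 1 := by
    intro m h h'
    have := hρ _ (Or.inr (Or.inl (Or.inr ⟨m, h, h', rfl⟩)))
    have e : ∀ p : Fin k, (p : ℕ) = m ↔ p = ⟨m, by omega⟩ := fun p => by simp [Fin.ext_iff]
    have e' : ∀ p : Fin k, (p : ℕ) = m + 1 ↔ p = ⟨m + 1, by omega⟩ :=
      fun p => by simp [Fin.ext_iff]
    simp [form, epsN, e, e', mul_sub, Finset.sum_sub_distrib] at this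
    linarith
  have hlast : ρ.1 ⟨k - 1, by omega⟩ = 1 / 2 := by
    have := hρ _ (Or.inr (Or.inr rfl))
    have e : ∀ p : Fin k, (p : ℕ) = k - 1 ↔ p = ⟨k - 1, by omega⟩ :=
      fun p => by simp [Fin.ext_iff]
    simp [form, epsN, e] at this
    linarith
  have hall : ∀ m (h : m < k), ρ.1 ⟨m, h⟩ = ρ.2.2.2 - 1 / 2 - ((max m l : ℕ) - (l : ℚ)) := by
    intro m
    induction m with
    | zero => intro h; simp; linarith
    | succ m ih =>
      intro h
      have ih := ih (by omega)
      by_cases hm : m < l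
      · have := hodd m hm
        have := hodd' m hm
        rw [max_eq_right hm.le] at ih
        rw [max_eq_right (show m + 1 ≤ l from hm)]
        linarith
      · have := heven m (by omega) (by omega)
        rw [max_eq_left (by omega)] at ih
        rw [max_eq_left (by omega)]
        push_cast
        linarith
  have hc : ρ.2.2.2 = (k : ℚ) - l := by
    have := hall (k - 1) (by omega)
    rw [hlast, max_eq_left (by omega), Nat.cast_sub (by omega)] at this
    push_cast at this
    linarith
  refine ⟨fun p => ?_, hc⟩
  rw [hall p p.2, hc]
  ring




lemma sum_fin_reindex {M : Type*} [AddCommMonoid M] (hkl : l ≤ k) (τ : Equiv.Perm (Fin k))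
    (F : Fin l → M) :
    ∑ g, F g = ∑ p, if h : (τ p : ℕ) < l then F ⟨τ p, h⟩ else 0 := by
  rw [Equiv.sum_comp τ (fun q : Fin k => if h : (q : ℕ) < l then F ⟨q, h⟩ else 0),
    Fin.sum_univ_eq_sum_range (fun i => if h : i < l then F ⟨i, h⟩ else 0) k,
    ← Finset.sum_subset (Finset.range_subset_range.2 hkl)
      (fun i _ hi => dif_neg (by simpa using hi)), ← Fin.sum_univ_eq_sum_range]
  simp

lemma abs_le_quadratic_term {u : ℤˣ} {m : ℤ} {a c N : ℚ} (ha : 1 / 2 ≤ a) (hac : a + 1 / 2 ≤ c)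
    (hN : N = 0 ∨ N = 1 ∧ 0 ≤ (u : ℤ) * m) :
    |(m : ℚ)| ≤ 2 * c * (m : ℚ) ^ 2 + 2 * a * ((u : ℤ) * m) + 2 * N * ((u : ℤ) * m) := by
  have hNm : 0 ≤ N * (((u : ℤ) : ℚ) * m) := by
    rcases hN with h | ⟨h, h'⟩
    · simp [h]
    · rw [h, one_mul]; exact_mod_cast h'
  have hum : -|(m : ℚ)| ≤ ((u : ℤ) : ℚ) * m := by
    rcases Int.units_eq_one_or u with h | h <;> simp [h, neg_abs_le, le_abs_self]
  have hsq : |(m : ℚ)| ≤ (m : ℚ) ^ 2 := by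
    rw [← sq_abs]
    have h : |(m : ℚ)| = 0 ∨ 1 ≤ |(m : ℚ)| := by
      rcases eq_or_ne m 0 with rfl | h
      · simp
      · exact Or.inr (by exact_mod_cast Int.one_le_abs h)
    rcases h with h | h <;> nlinarith
  have h0 := abs_nonneg (m : ℚ)
  nlinarith [mul_le_mul_of_nonneg_left hum (by linarith : (0 : ℚ) ≤ a),
    mul_le_mul_of_nonneg_left hsq (by linarith : (0 : ℚ) ≤ c)]

lemma sub_le_shifted_term {u : ℤˣ} {m : ℤ} {a a' c N : ℚ} {P : Prop} [Decidable P] (ha : 1 / 2 ≤ a)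
    (hac : a + 1 / 2 ≤ c) (hN : N = 0 ∨ N = 1 ∧ (0 < (u : ℤ) * m ∨ m = 0 ∧ (u = -1 ∨ P))) :
    a' - a - N * (if P then 1 else 0) ≤
      2 * c * (m : ℚ) ^ 2 + 2 * a * ((u : ℤ) * m) + 2 * N * ((u : ℤ) * m) +
        (a' - ((u : ℤ) * a + 2 * m * c) - N * (u : ℤ)) := by
  have hm : m = 0 ∨ (1 : ℚ) ≤ m ∨ (m : ℚ) ≤ -1 := by
    rcases lt_trichotomy m 0 with h | h | h
    · exact Or.inr (Or.inr (by exact_mod_cast Int.le_sub_one_of_lt h))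
    · exact Or.inl h
    · exact Or.inr (Or.inl (by exact_mod_cast h))
  have hP : (0 : ℚ) ≤ if P then 1 else 0 := by split_ifs <;> norm_num
  have hpos : (1 : ℚ) ≤ m → 0 ≤ c * m * (m - 1) ∧ 0 ≤ a * (m - 1) ∧ 0 ≤ (c * m - a) * (m - 1) := by
    intro h
    have : 0 ≤ c * m - a := by nlinarith
    exact ⟨mul_nonneg (by nlinarith) (by linarith), mul_nonneg (by linarith) (by linarith),
      mul_nonneg this (by linarith)⟩
  rcases hN with rfl | ⟨rfl, hN⟩
  · rcases Int.units_eq_one_or u with rfl | rfl <;> rcases hm with rfl | hm | hm <;>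
      push_cast
    · linarith
    · nlinarith [hpos hm]
    · nlinarith
    · linarith
    · nlinarith [hpos hm]
    · nlinarith
  · rcases hN with hN | ⟨rfl, hN⟩
    · rcases Int.units_eq_one_or u with rfl | rfl
      · have hN : (1 : ℚ) ≤ m := by
          have : 0 < m := by simpa using hN
          exact_mod_cast this
        push_cast
        nlinarith [hpos hN]
      · have hN : (m : ℚ) ≤ -1 := by
          have : m < 0 := by simpa using hN
          exact_mod_cast Int.le_sub_one_of_lt this
        push_cast
        nlinarith
    · rcases Int.units_eq_one_or u with rfl | rfl
      · have : P := by simpa using hN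
        simp [this]
      · push_cast
        linarith

/-- The indicator that `w` maps the element of `S` indexed by `q` out of `Δ̂⁺`; it vanishes when
`q` indexes no element of `S`. -/
def nonposIndicator (w : V k l ≃ₗ[ℚ] V k l) (q : Fin k) : ℤ :=
  if h : (q : ℕ) < l then (if w (Sv k l ⟨q, h⟩) ∈ DeltaHatPos k l then 0 else 1) else 0

lemma nonposIndicator_cases (hkl : l + 1 ≤ k) {w : V k l ≃ₗ[ℚ] V k l} {τ : Equiv.Perm (Fin k)}
    {σ : Fin k → ℤˣ} {m : Fin k → ℤ} (hw : ∀ v, w v = affineAct τ σ m v) (p : Fin k) :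
    nonposIndicator w (τ p) = 0 ∨ nonposIndicator w (τ p) = 1 ∧
      (0 < (σ p : ℤ) * m p ∨ m p = 0 ∧ (σ p = -1 ∨ τ p < p)) := by
  unfold nonposIndicator
  by_cases hq : (τ p : ℕ) < l
  · rw [dif_pos hq]
    by_cases hpos : w (Sv k l ⟨τ p, hq⟩) ∈ DeltaHatPos k l
    · simp [hpos]
    · refine Or.inr ⟨by simp [hpos], ?_⟩
      rw [hw] at hpos
      by_contra hcon
      push Not at hcon
      refine hpos (affineAct_Sv_mem_DeltaHatPos hkl τ σ m p hq ?_)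
      rcases hcon.1.lt_or_eq with h | h
      · exact Or.inl h
      · have hm : m p = 0 := by
          rcases Int.units_eq_one_or (σ p) with h' | h' <;> simpa [h'] using h
        have := hcon.2 hm
        exact Or.inr ⟨hm, (Int.units_eq_one_or (σ p)).resolve_right this.1, this.2⟩
  · simp [hq]

lemma nonposIndicator_sum_smul {w : V k l ≃ₗ[ℚ] V k l} {τ : Equiv.Perm (Fin k)}
    {σ : Fin k → ℤˣ} {m : Fin k → ℤ} (hkl : l ≤ k) (hw : ∀ v, w v = affineAct τ σ m v) :
    (∑ g : Fin l, (if w (Sv k l g) ∈ DeltaHatPos k l then 0 else w (Sv k l g))) =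
      ∑ p, (nonposIndicator w (τ p) : ℚ) •
        (((2 * (-((σ p : ℤ) * m p)) : ℤ) : ℚ) • dd k l + ((σ p : ℤ) : ℚ) • epsN k l p +
          (-1 : ℚ) • dlN k l (τ p)) := by
  rw [sum_fin_reindex hkl τ]
  refine Finset.sum_congr rfl fun p _ => ?_
  by_cases h : (τ p : ℕ) < l
  · by_cases hpos : w (Sv k l ⟨τ p, h⟩) ∈ DeltaHatPos k l
    · simp [h, hpos, nonposIndicator]
    · rw [← affineAct_Sv τ σ m p h, ← hw]
      simp [h, hpos, nonposIndicator]
  · simp [h, nonposIndicator]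

section Defect

variable {ρ : V k l} {w : V k l ≃ₗ[ℚ] V k l} {τ : Equiv.Perm (Fin k)} {σ : Fin k → ℤˣ}
  {m : Fin k → ℤ}

lemma defect_eps (hkl : l ≤ k) (hw : ∀ v, w v = affineAct τ σ m v) (p : Fin k) :
    (defect k l ρ w).1 p = ρ.1 p - ((σ p : ℤ) * ρ.1 (τ p) + 2 * m p * ρ.2.2.2) -
      nonposIndicator w (τ p) * (σ p : ℤ) := by
  rw [defect, nonposIndicator_sum_smul hkl hw, hw]
  simp [affineAct, Prod.fst_sum, Finset.sum_apply, dd, epsN, dlN, Fin.val_inj]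

lemma defect_dl (hkl : l ≤ k) (hw : ∀ v, w v = affineAct τ σ m v) (g : Fin l) :
    (defect k l ρ w).2.1 g = nonposIndicator w ⟨g, g.2.trans_le hkl⟩ := by
  rw [defect, nonposIndicator_sum_smul hkl hw, hw]
  have e : ∀ p : Fin k, (g : ℕ) = τ p ↔ p = τ.symm ⟨g, g.2.trans_le hkl⟩ := by
    intro p
    rw [Equiv.eq_symm_apply, Fin.ext_iff, eq_comm]
  simp [affineAct, Prod.fst_sum, Prod.snd_sum, Finset.sum_apply, dd, epsN, dlN, e]

lemma defect_delta (hkl : l ≤ k) (hw : ∀ v, w v = affineAct τ σ m v) :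
    (defect k l ρ w).2.2.1 = ∑ p, (2 * ρ.2.2.2 * (m p : ℚ) ^ 2 +
      2 * ρ.1 (τ p) * ((σ p : ℤ) * m p) + 2 * nonposIndicator w (τ p) * ((σ p : ℤ) * m p)) := by
  rw [defect, nonposIndicator_sum_smul hkl hw, hw]
  simp only [affineAct, Prod.fst_sum, Prod.snd_sum, dd, epsN, dlN, Prod.fst_sub, Prod.snd_sub,
    Prod.smul_fst, Prod.smul_snd, Prod.fst_add, Prod.snd_add, smul_eq_mul]
  rw [sub_sub_cancel, ← Finset.sum_sub_distrib]
  refine Finset.sum_congr rfl fun p _ => ?_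
  push_cast
  ring

lemma defect_lam (hkl : l ≤ k) (hw : ∀ v, w v = affineAct τ σ m v) :
    (defect k l ρ w).2.2.2 = 0 := by
  rw [defect, nonposIndicator_sum_smul hkl hw, hw]
  simp [affineAct, Prod.snd_sum, dd, epsN, dlN]

lemma rho_bounds (hkl : l + 1 ≤ k)
    (hρ : ∀ p : Fin k, ρ.1 p = (k : ℚ) - (max (p : ℕ) l : ℕ) - 1 / 2)
    (hc : ρ.2.2.2 = (k : ℚ) - l) (p : Fin k) :
    1 / 2 ≤ ρ.1 p ∧ ρ.1 p + 1 / 2 ≤ ρ.2.2.2 := by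
  have h1 : ((max (p : ℕ) l : ℕ) : ℚ) + 1 ≤ k := by
    have : max (p : ℕ) l + 1 ≤ k := by have := p.2; omega
    exact_mod_cast this
  have h2 : (l : ℚ) ≤ (max (p : ℕ) l : ℕ) := by exact_mod_cast le_max_right _ _
  rw [hρ, hc]
  constructor <;> linarith

lemma abs_le_defect_delta (hkl : l + 1 ≤ k) (hw : ∀ v, w v = affineAct τ σ m v)
    (hρ : ∀ p : Fin k, ρ.1 p = (k : ℚ) - (max (p : ℕ) l : ℕ) - 1 / 2)
    (hc : ρ.2.2.2 = (k : ℚ) - l) (p : Fin k) :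
    |(m p : ℚ)| ≤ (defect k l ρ w).2.2.1 := by
  rw [defect_delta (by omega) hw]
  have hterm : ∀ p, |(m p : ℚ)| ≤ 2 * ρ.2.2.2 * (m p : ℚ) ^ 2 +
      2 * ρ.1 (τ p) * ((σ p : ℤ) * m p) + 2 * nonposIndicator w (τ p) * ((σ p : ℤ) * m p) := by
    intro p
    obtain ⟨ha, hac⟩ := rho_bounds hkl hρ hc (τ p)
    refine abs_le_quadratic_term ha hac ?_
    rcases nonposIndicator_cases hkl hw p with h | ⟨h, h' | ⟨h', _⟩⟩
    · simp [h]
    · simp [h, h'.le]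
    · simp [h, h']
  exact (hterm p).trans (Finset.single_le_sum (fun q _ => (abs_nonneg _).trans (hterm q))
    (Finset.mem_univ p))

lemma prefixSum_defect_nonneg (hkl : l + 1 ≤ k) (hw : ∀ v, w v = affineAct τ σ m v)
    (hρ : ∀ p : Fin k, ρ.1 p = (k : ℚ) - (max (p : ℕ) l : ℕ) - 1 / 2)
    (hc : ρ.2.2.2 = (k : ℚ) - l) {n n' : ℕ} (hn : n ≤ n' + 1) :
    0 ≤ prefixSum (defect k l ρ w) n n' := by
  have hN : ∀ q, (0 : ℚ) ≤ nonposIndicator w q := by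
    intro q
    have h := nonposIndicator_cases hkl hw (τ.symm q)
    rw [Equiv.apply_symm_apply] at h
    rcases h with h | ⟨h, _⟩ <;> simp [h]
  have hterm : ∀ p : Fin k, (if (p : ℕ) < n then 1 else 0) * ρ.1 p -
      (if (p : ℕ) < n then 1 else 0) * ρ.1 (τ p) -
      (if (τ p : ℕ) < n' then 1 else 0) * (nonposIndicator w (τ p) : ℚ) ≤
      (2 * ρ.2.2.2 * (m p : ℚ) ^ 2 +
        2 * ρ.1 (τ p) * ((σ p : ℤ) * m p) + 2 * nonposIndicator w (τ p) * ((σ p : ℤ) * m p)) +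
      (if (p : ℕ) < n then (defect k l ρ w).1 p else 0) := by
    intro p
    obtain ⟨ha, hac⟩ := rho_bounds hkl hρ hc (τ p)
    have hcases := nonposIndicator_cases hkl hw p
    by_cases hp : (p : ℕ) < n
    · have h := sub_le_shifted_term (u := σ p) (m := m p) (a' := ρ.1 p)
        (N := nonposIndicator w (τ p)) (P := τ p < p) ha hac (by exact_mod_cast hcases)
      rw [if_pos hp, if_pos hp, defect_eps (by omega) hw]
      have hle : (nonposIndicator w (τ p) : ℚ) * (if τ p < p then 1 else 0) ≤
          (if (τ p : ℕ) < n' then 1 else 0) * (nonposIndicator w (τ p) : ℚ) := by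
        by_cases hlt : τ p < p
        · have : (τ p : ℕ) < n' := by
            have : (τ p : ℕ) < p := hlt
            omega
          simp [hlt, this]
        · rw [if_neg hlt, mul_zero]
          exact mul_nonneg (by split_ifs <;> simp) (hN _)
      linarith
    · have h := abs_le_quadratic_term (u := σ p) (m := m p) (N := nonposIndicator w (τ p)) ha hac
        (by
          rcases hcases with h | ⟨h, h' | ⟨h', _⟩⟩
          · simp [h]
          · simp [h, h'.le]
          · simp [h, h'])
      have h0 := abs_nonneg (m p : ℚ)
      have hle : 0 ≤ (if (τ p : ℕ) < n' then 1 else 0) * (nonposIndicator w (τ p) : ℚ) :=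
        mul_nonneg (by split_ifs <;> simp) (hN _)
      rw [if_neg hp, if_neg hp]
      linarith
  have hsum := Finset.sum_le_sum fun p (_ : p ∈ Finset.univ) => hterm p
  rw [Finset.sum_sub_distrib, Finset.sum_sub_distrib, Finset.sum_add_distrib,
    ← defect_delta (by omega) hw] at hsum
  have hrearr : ∑ p : Fin k, (if (p : ℕ) < n then (1 : ℚ) else 0) * ρ.1 (τ p) ≤
      ∑ p : Fin k, (if (p : ℕ) < n then (1 : ℚ) else 0) * ρ.1 p := by
    have hf : Antitone fun p : Fin k => if (p : ℕ) < n then (1 : ℚ) else 0 := by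
      intro p q hpq
      have : (p : ℕ) ≤ q := hpq
      dsimp only
      split_ifs <;> first | omega | norm_num
    have hg : Antitone ρ.1 := by
      intro p q hpq
      have : (p : ℕ) ≤ q := hpq
      rw [hρ, hρ]
      have : ((max (p : ℕ) l : ℕ) : ℚ) ≤ (max (q : ℕ) l : ℕ) := by
        exact_mod_cast max_le_max_right l this
      linarith
    exact (hf.monovary hg).sum_mul_comp_perm_le_sum_mul
  have hdl : (∑ g : Fin l, if (g : ℕ) < n' then (defect k l ρ w).2.1 g else 0) =
      ∑ p : Fin k, (if (τ p : ℕ) < n' then 1 else 0) * (nonposIndicator w (τ p) : ℚ) := by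
    rw [sum_fin_reindex (by omega : l ≤ k) τ]
    refine Finset.sum_congr rfl fun p _ => ?_
    by_cases h : (τ p : ℕ) < l
    · simp [h, defect_dl (by omega : l ≤ k) hw]
    · simp [h, nonposIndicator]
  rw [prefixSum, hdl]
  linarith

lemma sub_mem_Qp_defect (hkl : l + 1 ≤ k) (hw : ∀ v, w v = affineAct τ σ m v)
    (hρ : ∀ p : Fin k, ρ.1 p = (k : ℚ) - (max (p : ℕ) l : ℕ) - 1 / 2)
    (hc : ρ.2.2.2 = (k : ℚ) - l) :
    (∃ a : ℤ, (defect k l ρ w).2.2.1 = a) ∧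
    defect k l ρ w - (defect k l ρ w).2.2.1 • (dd k l - epsN k l 0) ∈ Qp k l := by
  have hz : ∃ a : ℤ, (defect k l ρ w).2.2.1 = a := by
    refine ⟨∑ p, (2 * ((k : ℤ) - l) * (m p) ^ 2 +
      (2 * ((k : ℤ) - (max (τ p : ℕ) l : ℕ)) - 1) * ((σ p : ℤ) * m p) +
        2 * nonposIndicator w (τ p) * ((σ p : ℤ) * m p)), ?_⟩
    rw [defect_delta (by omega) hw, Int.cast_sum]
    refine Finset.sum_congr rfl fun p _ => ?_
    rw [hρ, hc]
    push_cast
    ring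
  refine ⟨hz, sub_mem_Qp_of_prefixSum_nonneg hkl ?_ ?_ hz (defect_lam (by omega) hw)
    fun n n' _ h => prefixSum_defect_nonneg hkl hw hρ hc h⟩
  · intro p
    rw [defect_eps (by omega) hw, hρ, hρ, hc]
    rcases Int.units_eq_one_or (σ p) with h | h
    · refine ⟨(max (τ p : ℕ) l : ℕ) - (max (p : ℕ) l : ℕ) - 2 * m p * ((k : ℤ) - l) -
        nonposIndicator w (τ p), ?_⟩
      rw [h]
      push_cast
      ring
    · refine ⟨2 * k - (max (τ p : ℕ) l : ℕ) - (max (p : ℕ) l : ℕ) - 1 -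
        2 * m p * ((k : ℤ) - l) + nonposIndicator w (τ p), ?_⟩
      rw [h]
      push_cast
      ring
  · intro g
    exact ⟨_, defect_dl (by omega) hw g⟩

end Defect

end Auxiliary

/-- **Well-definedness of the twisted Weyl-group sum for `D(k+1,l)^(2)`.**
(i) For every `w ∈ Ŵ′` one has `wβ ∈ Δ̂` for all `β ∈ S`, and
`ρ̂ − w(ρ̂) − Σ_{β∈S, wβ∉Δ̂⁺} w(β) ∈ Q̂⁺`.
(ii) For every `r ∈ ℕ`, the set of `w ∈ Ŵ′` with
`ht(ρ̂ − w(ρ̂) − Σ_{β∈S, wβ∉Δ̂⁺} w(β)) ≤ r` is finite, where `ht` is the linear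
functional with `ht(α) = 1` for every simple root `α ∈ π̂`. -/
theorem weyl_sum_well_defined_D_twisted (hl : 1 ≤ l) (hkl : l + 1 ≤ k)
    (ρ : V k l)
    (hρspan : ρ ∈ Submodule.span ℚ
      ((Set.range fun i : Fin k => epsN k l i) ∪ (Set.range fun g : Fin l => dlN k l g) ∪
        {lam k l}))
    (hρ : ∀ α ∈ piHatSet k l, form k l ρ α = form k l α α / 2)
    (ht : V k l →ₗ[ℚ] ℚ) (hht : ∀ α ∈ piHatSet k l, ht α = 1) :
    (∀ w ∈ Wp k l,
        (∀ g : Fin l, w (Sv k l g) ∈ DeltaHat k l) ∧ defect k l ρ w ∈ Qp k l) ∧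
    (∀ r : ℕ,
        {w : V k l ≃ₗ[ℚ] V k l | w ∈ Wp k l ∧ ht (defect k l ρ w) ≤ (r : ℚ)}.Finite) := by
  obtain ⟨hρ', hc⟩ := rho_coordinates hl hkl hρ
  have hα : dd k l - epsN k l 0 ∈ piHatSet k l := Or.inl rfl
  refine ⟨fun w hw => ?_, fun r => ?_⟩
  · obtain ⟨τ, σ, m, hw⟩ := exists_affineAct_of_mem_Wp hw
    refine ⟨fun g => ?_, ?_⟩
    · obtain ⟨p, hp⟩ := τ.surjective ⟨g, by have := g.2; omega⟩
      have hp' : (τ p : ℕ) = g := congrArg Fin.val hp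
      have h := affineAct_Sv_mem_DeltaHat τ σ m p (hp' ▸ g.2)
      rw [← hw] at h
      convert h using 3
      exact Fin.ext hp'.symm
    · obtain ⟨⟨z, hz⟩, hmem⟩ := sub_mem_Qp_defect hkl hw hρ' hc
      have h0 := (abs_nonneg _).trans (abs_le_defect_delta hkl hw hρ' hc ⟨0, by omega⟩)
      simpa using add_mem hmem (smul_mem_Qp hz h0 (AddSubmonoid.subset_closure hα))
  · have hfin : (Set.range (fun x : Equiv.Perm (Fin k) × (Fin k → ℤˣ) ×
        Set.Icc (fun _ : Fin k => -(r : ℤ)) (fun _ => (r : ℤ)) =>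
          (affineAct x.1 x.2.1 x.2.2 : V k l → V k l))).Finite := by
      have := (Set.finite_Icc (fun _ : Fin k => -(r : ℤ)) (fun _ => (r : ℤ))).to_subtype
      exact Set.finite_range _
    refine (hfin.preimage (f := fun w : V k l ≃ₗ[ℚ] V k l => (w : V k l → V k l))
      DFunLike.coe_injective.injOn).subset ?_
    rintro w ⟨hw, hr⟩
    obtain ⟨τ, σ, m, hw⟩ := exists_affineAct_of_mem_Wp hw
    have hm : ∀ p, |m p| ≤ (r : ℤ) := by
      intro p
      have h := height_nonneg hht (sub_mem_Qp_defect hkl hw hρ' hc).2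
      rw [map_sub, map_smul, hht _ hα, smul_eq_mul, mul_one] at h
      have := abs_le_defect_delta hkl hw hρ' hc p
      have : |(m p : ℚ)| ≤ r := by linarith
      exact_mod_cast this
    exact ⟨⟨τ, σ, m, fun p => (abs_le.1 (hm p)).1, fun p => (abs_le.1 (hm p)).2⟩,
      funext fun v => (hw v).symm⟩

end Stmt9
end
end

section
/- (Triviality of the stabilizing set A, case A(2k,2k+1)^(2).) Suppose w = t_μ∘y, where μ ∈ M := {a₁ε₁+⋯+a_{k+1}ε_{k+1} : a_i ∈ ℤ, a₁+⋯+a_{k+1} even} and y ∈ W′ is a signed permutation of ε₁,…,ε_{k+1} (a linear automorphism of V with y(ε_i) = ±ε_{σ(i)} for a permutation σ, fixing δ₁,…,δ_k, δ, Λ₀). If w(ρ̂) = ρ̂ and w(δ_i − ε_{i+1}) ∈ Δ̂⁺ for every i = 1,…,k, then μ = 0 and y is the identity. -/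
/-!
Triviality of the stabilizing set `A`, case `A(2k,2k+1)^(2)`:
if `w = t_μ∘y` with `μ ∈ M = {Σ a_iε_i : a_i ∈ ℤ, Σ a_i even}` and `y` a signed
permutation of `ε₁,…,ε_{k+1}` fixing `δ₁,…,δ_k, δ, Λ₀`, and if `w(ρ̂) = ρ̂` and
`w(δ_i − ε_{i+1}) ∈ Δ̂⁺` for `i = 1,…,k`, then `μ = 0` and `y = id`.
-/

open scoped BigOperators Classical

noncomputable section

namespace Stmt10

variable (k : ℕ)

/-- Weight space, with basis `ε₁,…,ε_{k+1}, δ₁,…,δ_k, δ, Λ₀`. -/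
abbrev V : Type := (Fin (k + 1) → ℚ) × (Fin k → ℚ) × ℚ × ℚ

/-- `ε_{m+1}` (0-indexed: `epsN m`). -/
def epsN (m : ℕ) : V k := (fun i => if (i : ℕ) = m then 1 else 0, 0, 0, 0)

/-- `δ_{m+1}` (0-indexed: `dlN m`). -/
def dlN (m : ℕ) : V k := (0, fun g => if (g : ℕ) = m then 1 else 0, 0, 0)

/-- the minimal imaginary root `δ`. -/
def dd : V k := (0, 0, 1, 0)

/-- `Λ₀`. -/
def lam : V k := (0, 0, 0, 1)

/-- The bilinear form: `(ε_i,ε_j)=δ_{ij}`, `(δ_g,δ_h)=−δ_{gh}`, `(ε_i,δ_g)=0`,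
`δ,Λ₀` isotropic and orthogonal to all `ε_i, δ_g`, `(δ,Λ₀)=1`. -/
def form (x y : V k) : ℚ :=
  (∑ i, x.1 i * y.1 i) - (∑ g, x.2.1 g * y.2.1 g) + x.2.2.1 * y.2.2.2 + x.2.2.2 * y.2.2.1

/-- sign attached to a boolean -/
def sg (b : Bool) : ℚ := cond b 1 (-1)

/-- The set `Δ̂` of roots of `A(2k,2k+1)^(2)`:
even roots `sδ±δ_g±δ_h (g<h)`, `sδ±δ_g`, `(2s+1)δ±2δ_g`, `sδ±ε_i±ε_j (i<j)`,
`2sδ±2ε_i`, `sδ (s≠0)`; odd roots `sδ±ε_i±δ_g`, `sδ±ε_i`. -/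
def DeltaHat : Set (V k) :=
  {v | ∃ s : ℤ, ∃ b₁ b₂ : Bool, ∃ g h : Fin k, (g : ℕ) < (h : ℕ) ∧
      v = (s : ℚ) • dd k + sg b₁ • dlN k g + sg b₂ • dlN k h} ∪
  {v | ∃ s : ℤ, ∃ b : Bool, ∃ g : Fin k, v = (s : ℚ) • dd k + sg b • dlN k g} ∪
  {v | ∃ s : ℤ, ∃ b : Bool, ∃ g : Fin k,
      v = ((2 * s + 1 : ℤ) : ℚ) • dd k + (2 * sg b) • dlN k g} ∪
  {v | ∃ s : ℤ, ∃ b₁ b₂ : Bool, ∃ i j : Fin (k + 1), (i : ℕ) < (j : ℕ) ∧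
      v = (s : ℚ) • dd k + sg b₁ • epsN k i + sg b₂ • epsN k j} ∪
  {v | ∃ s : ℤ, ∃ b : Bool, ∃ i : Fin (k + 1),
      v = ((2 * s : ℤ) : ℚ) • dd k + (2 * sg b) • epsN k i} ∪
  {v | ∃ s : ℤ, s ≠ 0 ∧ v = (s : ℚ) • dd k} ∪
  {v | ∃ s : ℤ, ∃ b₁ b₂ : Bool, ∃ i : Fin (k + 1), ∃ g : Fin k,
      v = (s : ℚ) • dd k + sg b₁ • epsN k i + sg b₂ • dlN k g} ∪
  {v | ∃ s : ℤ, ∃ b : Bool, ∃ i : Fin (k + 1), v = (s : ℚ) • dd k + sg b • epsN k i}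

/-- The simple roots
`π̂ = {δ−δ₁−ε₁, ε₁−δ₁, δ₁−ε₂, ε₂−δ₂, …, ε_k−δ_k, δ_k−ε_{k+1}, ε_{k+1}}`. -/
def piHatSet : Set (V k) :=
  {v | v = dd k - dlN k 0 - epsN k 0} ∪
  {v | ∃ m : ℕ, m + 1 ≤ k ∧ v = epsN k m - dlN k m} ∪
  {v | ∃ m : ℕ, m + 1 ≤ k ∧ v = dlN k m - epsN k (m + 1)} ∪
  {v | v = epsN k k}

/-- `Q̂⁺`, the ℕ-span of `π̂`. -/
def Qp : AddSubmonoid (V k) := AddSubmonoid.closure (piHatSet k)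

/-- `Δ̂⁺ = Δ̂ ∩ (ℕπ̂∖{0})`. -/
def DeltaHatPos : Set (V k) := {v | v ∈ DeltaHat k ∧ v ∈ Qp k ∧ v ≠ 0}

/-- `ρ̂ = Λ₀ + (1/2)·(Σ_{i=1}^{k}(ε_i−δ_i) + ε_{k+1})`. -/
def rho : V k :=
  lam k + (2 : ℚ)⁻¹ • (∑ i : Fin (k + 1), epsN k i - ∑ g : Fin k, dlN k g)

/-- the translation `t_μ` on weights. -/
def tmap (μ x : V k) : V k :=
  x + form k x (dd k) • μ - (form k x μ + form k μ μ / 2 * form k x (dd k)) • dd k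

/-- A height function on `V`, positive on the simple roots. -/
def height : V k →ₗ[ℚ] ℚ where
  toFun v := (∑ i : Fin (k + 1), (2 * ((k : ℚ) - (i : ℕ)) + 1) * v.1 i)
    + (∑ g : Fin k, 2 * ((k : ℚ) - (g : ℕ)) * v.2.1 g) + (4 * (k : ℚ) + 4) * v.2.2.1
  map_add' u v := by
    simp only [Prod.fst_add, Prod.snd_add, Pi.add_apply, mul_add, Finset.sum_add_distrib]
    ring
  map_smul' c v := by
    simp only [Prod.smul_fst, Prod.smul_snd, Pi.smul_apply, smul_eq_mul, RingHom.id_apply,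
      mul_add, Finset.mul_sum]
    simp only [mul_left_comm c]

lemma height_epsN (i : Fin (k + 1)) : height k (epsN k i) = 2 * ((k : ℚ) - (i : ℕ)) + 1 := by
  simp [height, epsN, Fin.val_inj]

lemma height_dlN (g : Fin k) : height k (dlN k g) = 2 * ((k : ℚ) - (g : ℕ)) := by
  simp [height, dlN, Fin.val_inj]

lemma height_dd : height k (dd k) = 4 * (k : ℚ) + 4 := by
  simp [height, dd]

lemma height_nonneg_of_mem_Qp (hk : 1 ≤ k) {v : V k} (hv : v ∈ Qp k) : 0 ≤ height k v := by
  have he : ∀ m : ℕ, m ≤ k → height k (epsN k m) = 2 * ((k : ℚ) - m) + 1 := fun m hm =>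
    height_epsN k ⟨m, Nat.lt_succ_of_le hm⟩
  have hd : ∀ m : ℕ, m < k → height k (dlN k m) = 2 * ((k : ℚ) - m) := fun m hm =>
    height_dlN k ⟨m, hm⟩
  induction hv using AddSubmonoid.closure_induction with
  | mem x hx =>
    rcases hx with ((rfl | ⟨m, hm, rfl⟩) | ⟨m, hm, rfl⟩) | hx
    · rw [map_sub, map_sub, height_dd, hd 0 (by omega), he 0 (by omega)]
      push_cast
      linarith
    · rw [map_sub, hd m (by omega), he m (by omega)]
      linarith
    · rw [map_sub, hd m (by omega), he (m + 1) (by omega)]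
      push_cast
      linarith
    · rw [show x = epsN k k from hx, he k le_rfl]
      linarith
  | zero => simp
  | add x z _ _ hx hz => rw [map_add]; exact add_nonneg hx hz

lemma eq_sum_basis (v : V k) :
    v = (∑ i : Fin (k + 1), v.1 i • epsN k i) + (∑ g : Fin k, v.2.1 g • dlN k g)
      + v.2.2.1 • dd k + v.2.2.2 • lam k := by
  refine Prod.ext ?_ (Prod.ext ?_ (Prod.ext ?_ ?_))
  · funext j
    simp [Prod.fst_sum, epsN, dlN, dd, lam, Fin.val_inj]
  · funext j
    simp [Prod.fst_sum, Prod.snd_sum, epsN, dlN, dd, lam, Fin.val_inj]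
  · simp [Prod.snd_sum, epsN, dlN, dd, lam]
  · simp [Prod.snd_sum, epsN, dlN, dd, lam]

/-- The vector `Σ aᵢεᵢ` in coordinates. -/
lemma sum_smul_epsN (a : Fin (k + 1) → ℚ) :
    ∑ i : Fin (k + 1), a i • epsN k i = (a, 0, 0, 0) := by
  refine Prod.ext ?_ (Prod.ext ?_ (Prod.ext ?_ ?_))
  · funext j
    simp [Prod.fst_sum, epsN, Fin.val_inj]
  all_goals simp [Prod.snd_sum, epsN]

lemma tmap_dlN_sub (a : Fin (k + 1) → ℚ) (s : ℚ) (m : ℕ) (j : Fin (k + 1)) :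
    tmap k (a, 0, 0, 0) (dlN k m - s • epsN k j) =
      dlN k m - s • epsN k j + (s * a j) • dd k := by
  simp [tmap, form, dlN, epsN, dd, Fin.val_inj]

lemma fst_tmap_rho_image (a s : Fin (k + 1) → ℚ) (σ : Equiv.Perm (Fin (k + 1)))
    (i : Fin (k + 1)) :
    (tmap k (a, 0, 0, 0) (lam k + (2 : ℚ)⁻¹ •
      (∑ i : Fin (k + 1), s i • epsN k (σ i) - ∑ g : Fin k, dlN k g))).1 (σ i)
      = s i / 2 + a (σ i) := by
  simp [tmap, form, lam, dlN, epsN, dd, Prod.fst_sum, Prod.snd_sum, Fin.val_inj]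
  ring

lemma fst_rho (j : Fin (k + 1)) : (rho k).1 j = 1 / 2 := by
  simp [rho, lam, dlN, epsN, Prod.fst_sum, Fin.val_inj]

lemma perm_eq_one_of_le {n : ℕ} (σ : Equiv.Perm (Fin n)) (h : ∀ i, i ≤ σ i) : σ = 1 := by
  have hsum : ∑ i, ((σ i : Fin n) : ℕ) = ∑ i : Fin n, (i : ℕ) :=
    Equiv.sum_comp σ (fun i : Fin n => (i : ℕ))
  have heq := (Finset.sum_eq_sum_iff_of_le (s := Finset.univ)
    (fun i _ => (Fin.le_def.mp (h i)))).mp hsum.symm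
  exact Equiv.ext fun i => (Fin.ext (heq i (Finset.mem_univ i))).symm

/-- **Triviality of the stabilizing set `A`, case `A(2k,2k+1)^(2)`.**
Suppose `w = t_μ∘y` with `μ = Σ a_iε_i`, `a_i ∈ ℤ`, `Σ a_i` even, and `y ∈ W′`
a signed permutation of `ε₁,…,ε_{k+1}` fixing `δ₁,…,δ_k, δ, Λ₀`.
If `w(ρ̂) = ρ̂` and `w(δ_i−ε_{i+1}) ∈ Δ̂⁺` for every `i = 1,…,k`, then `μ = 0`
and `y` is the identity. -/
theorem stabilizer_trivial_A_2k_2kp1 (hk : 1 ≤ k)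
    (a : Fin (k + 1) → ℤ) (ha : Even (∑ i, a i))
    (μ : V k) (hμ : μ = ∑ i : Fin (k + 1), (a i : ℚ) • epsN k i)
    (y : V k ≃ₗ[ℚ] V k) (σ : Equiv.Perm (Fin (k + 1)))
    (hyε : ∀ i : Fin (k + 1), y (epsN k i) = epsN k (σ i) ∨ y (epsN k i) = -epsN k (σ i))
    (hyδ : ∀ g : Fin k, y (dlN k g) = dlN k g)
    (hyd : y (dd k) = dd k) (hyl : y (lam k) = lam k)
    (hwρ : tmap k μ (y (rho k)) = rho k)
    (hwS : ∀ m : ℕ, m + 1 ≤ k →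
      tmap k μ (y (dlN k m - epsN k (m + 1))) ∈ DeltaHatPos k) :
    μ = 0 ∧ ∀ v : V k, y v = v := by
  have hμ' : μ = (fun i => (a i : ℚ), 0, 0, 0) := by
    rw [hμ]
    exact sum_smul_epsN k (fun i => (a i : ℚ))
  have hsign : ∀ i : Fin (k + 1), ∃ s : ℚ, (s = 1 ∨ s = -1) ∧ y (epsN k i) = s • epsN k (σ i) := by
    intro i
    rcases hyε i with h | h
    · exact ⟨1, Or.inl rfl, by simp [h]⟩
    · exact ⟨-1, Or.inr rfl, by simp [h]⟩
  choose s hs hys using hsign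
  have hyρ : y (rho k) = lam k + (2 : ℚ)⁻¹ •
      (∑ i : Fin (k + 1), s i • epsN k (σ i) - ∑ g : Fin k, dlN k g) := by
    simp only [rho, map_add, map_smul, map_sub, map_sum, hyl, hys, hyδ]
  have hsa : ∀ i, s i / 2 + a (σ i) = 1 / 2 := by
    intro i
    rw [← fst_rho k (σ i), ← hwρ, hyρ, hμ']
    exact (fst_tmap_rho_image k (fun i => (a i : ℚ)) s σ i).symm
  have hpos : ∀ m : Fin k, 0 ≤ 2 * ((k : ℚ) - (m : ℕ))
      - s m.succ * (2 * ((k : ℚ) - (σ m.succ : ℕ)) + 1)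
      + s m.succ * a (σ m.succ) * (4 * (k : ℚ) + 4) := by
    intro m
    have h := height_nonneg_of_mem_Qp k hk (hwS m m.isLt).2.1
    have hy : y (epsN k (m + 1)) = s m.succ • epsN k (σ m.succ) := hys m.succ
    rw [map_sub, hyδ, hy, hμ', tmap_dlN_sub] at h
    simpa only [map_add, map_sub, map_smul, height_epsN, height_dlN, height_dd,
      smul_eq_mul] using h
  have hs_succ : ∀ m : Fin k, s m.succ = 1 := by
    intro m
    refine (hs m.succ).resolve_right fun h => ?_
    have h1 := hsa m.succ
    have h2 := hpos m
    have ha1 : (a (σ m.succ) : ℚ) = 1 := by rw [h] at h1; linarith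
    rw [h, ha1] at h2
    have hm : (0 : ℚ) ≤ (m : ℕ) := Nat.cast_nonneg _
    have hj : (0 : ℚ) ≤ (σ m.succ : ℕ) := Nat.cast_nonneg _
    linarith
  have ha_of : ∀ i, s i = 1 → a (σ i) = 0 := by
    intro i h
    have h1 := hsa i
    rw [h] at h1
    exact_mod_cast (by linarith : (a (σ i) : ℚ) = 0)
  have hs_zero : s 0 = 1 := by
    refine (hs 0).resolve_right fun h => ?_
    have h1 := hsa 0
    rw [h] at h1
    have ha1 : a (σ 0) = 1 := by exact_mod_cast (by linarith : (a (σ 0) : ℚ) = 1)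
    rw [← Equiv.sum_comp σ a, Fin.sum_univ_succ, ha1,
      Finset.sum_eq_zero fun m _ => ha_of _ (hs_succ m)] at ha
    exact absurd ha (by decide)
  have hs_one : ∀ i, s i = 1 := Fin.cases hs_zero hs_succ
  have ha_zero : ∀ j, a j = 0 := fun j => by
    simpa using ha_of (σ.symm j) (hs_one _)
  have hσ : σ = 1 := by
    refine perm_eq_one_of_le σ (Fin.cases (Fin.zero_le _) fun m => ?_)
    have h := hpos m
    rw [hs_one, ha_zero] at h
    push_cast at h
    have h' : ((m : ℕ) : ℚ) < (σ m.succ : ℕ) := by linarith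
    rw [Fin.le_def, Fin.val_succ]
    exact_mod_cast h'
  refine ⟨by simp [hμ, ha_zero], fun v => ?_⟩
  have hyε' : ∀ i : Fin (k + 1), y (epsN k i) = epsN k i := fun i => by
    simp [hys, hs_one, hσ]
  rw [eq_sum_basis k v]
  simp only [map_add, map_sum, map_smul, hyε', hyδ, hyd, hyl]

end Stmt10
end
end

section
/- (Triviality of the stabilizing set A, case A(2k,2k−1)^(2).) Suppose w = t_μ∘y, where μ ∈ ℤε₁+⋯+ℤε_k and y ∈ W′ is a signed permutation of ε₁,…,ε_k (a linear automorphism of V with y(ε_i) = ±ε_{σ(i)} for a permutation σ, fixing δ₁,…,δ_k, δ, Λ₀). If w(ρ̂) = ρ̂ and w(δ_i − ε_i) ∈ Δ̂⁺ for every i = 1,…,k, then μ = 0 and y is the identity. -/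
/-!
Triviality of the stabilizing set `A`, case `A(2k,2k−1)^(2)`:
if `w = t_μ∘y` with `μ ∈ ℤε₁+⋯+ℤε_k` and `y` a signed permutation of
`ε₁,…,ε_k` fixing `δ₁,…,δ_k, δ, Λ₀`, and if `w(ρ̂) = ρ̂` and
`w(δ_i − ε_i) ∈ Δ̂⁺` for `i = 1,…,k`, then `μ = 0` and `y = id`.
-/

open scoped BigOperators Classical

noncomputable section

namespace Stmt11

variable (k : ℕ)

/-- Weight space, with basis `ε₁,…,ε_k, δ₁,…,δ_k, δ, Λ₀`. -/
abbrev V : Type := (Fin k → ℚ) × (Fin k → ℚ) × ℚ × ℚ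

/-- `ε_{m+1}` (0-indexed: `epsN m`). -/
def epsN (m : ℕ) : V k := (fun i => if (i : ℕ) = m then 1 else 0, 0, 0, 0)

/-- `δ_{m+1}` (0-indexed: `dlN m`). -/
def dlN (m : ℕ) : V k := (0, fun g => if (g : ℕ) = m then 1 else 0, 0, 0)

/-- the minimal imaginary root `δ`. -/
def dd : V k := (0, 0, 1, 0)

/-- `Λ₀`. -/
def lam : V k := (0, 0, 0, 1)

/-- The bilinear form: `(ε_i,ε_j)=δ_{ij}`, `(δ_g,δ_h)=−δ_{gh}`, `(ε_i,δ_g)=0`,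
`δ,Λ₀` isotropic and orthogonal to all `ε_i, δ_g`, `(δ,Λ₀)=1`. -/
def form (x y : V k) : ℚ :=
  (∑ i, x.1 i * y.1 i) - (∑ g, x.2.1 g * y.2.1 g) + x.2.2.1 * y.2.2.2 + x.2.2.2 * y.2.2.1

/-- sign attached to a boolean -/
def sg (b : Bool) : ℚ := cond b 1 (-1)

/-- The set `Δ̂` of roots of `A(2k,2k−1)^(2)`:
even roots `sδ±ε_i±ε_j (i<j)`, `sδ±ε_i`, `(2s+1)δ±2ε_i`, `sδ±δ_g±δ_h (g<h)`,
`2sδ±2δ_g`, `sδ (s≠0)`; odd roots `sδ±δ_g±ε_i`, `sδ±δ_g`. -/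
def DeltaHat : Set (V k) :=
  {v | ∃ s : ℤ, ∃ b₁ b₂ : Bool, ∃ i j : Fin k, (i : ℕ) < (j : ℕ) ∧
      v = (s : ℚ) • dd k + sg b₁ • epsN k i + sg b₂ • epsN k j} ∪
  {v | ∃ s : ℤ, ∃ b : Bool, ∃ i : Fin k, v = (s : ℚ) • dd k + sg b • epsN k i} ∪
  {v | ∃ s : ℤ, ∃ b : Bool, ∃ i : Fin k,
      v = ((2 * s + 1 : ℤ) : ℚ) • dd k + (2 * sg b) • epsN k i} ∪
  {v | ∃ s : ℤ, ∃ b₁ b₂ : Bool, ∃ g h : Fin k, (g : ℕ) < (h : ℕ) ∧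
      v = (s : ℚ) • dd k + sg b₁ • dlN k g + sg b₂ • dlN k h} ∪
  {v | ∃ s : ℤ, ∃ b : Bool, ∃ g : Fin k,
      v = ((2 * s : ℤ) : ℚ) • dd k + (2 * sg b) • dlN k g} ∪
  {v | ∃ s : ℤ, s ≠ 0 ∧ v = (s : ℚ) • dd k} ∪
  {v | ∃ s : ℤ, ∃ b₁ b₂ : Bool, ∃ g : Fin k, ∃ i : Fin k,
      v = (s : ℚ) • dd k + sg b₁ • dlN k g + sg b₂ • epsN k i} ∪
  {v | ∃ s : ℤ, ∃ b : Bool, ∃ g : Fin k, v = (s : ℚ) • dd k + sg b • dlN k g}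

/-- The simple roots
`π̂ = {δ−ε₁−δ₁, δ₁−ε₁, ε₁−δ₂, δ₂−ε₂, …, ε_{k−1}−δ_k, δ_k−ε_k, ε_k}`. -/
def piHatSet : Set (V k) :=
  {v | v = dd k - epsN k 0 - dlN k 0} ∪
  {v | ∃ m : ℕ, m + 1 ≤ k ∧ v = dlN k m - epsN k m} ∪
  {v | ∃ m : ℕ, m + 2 ≤ k ∧ v = epsN k m - dlN k (m + 1)} ∪
  {v | v = epsN k (k - 1)}

/-- `Q̂⁺`, the ℕ-span of `π̂`. -/
def Qp : AddSubmonoid (V k) := AddSubmonoid.closure (piHatSet k)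

/-- `Δ̂⁺ = Δ̂ ∩ (ℕπ̂∖{0})`. -/
def DeltaHatPos : Set (V k) := {v | v ∈ DeltaHat k ∧ v ∈ Qp k ∧ v ≠ 0}

/-- `ρ̂ = Λ₀ + (1/2)·Σ_{i=1}^{k}(ε_i−δ_i)`. -/
def rho : V k :=
  lam k + (2 : ℚ)⁻¹ • (∑ i : Fin k, epsN k i - ∑ g : Fin k, dlN k g)

/-- the translation `t_μ` on weights. -/
def tmap (μ x : V k) : V k :=
  x + form k x (dd k) • μ - (form k x μ + form k μ μ / 2 * form k x (dd k)) • dd k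

section Helpers

variable {k}

theorem Qp_nonneg {f : V k →ₗ[ℚ] ℚ} (hf : ∀ v ∈ piHatSet k, 0 ≤ f v) {v : V k} (hv : v ∈ Qp k) :
    0 ≤ f v := by
  induction hv using AddSubmonoid.closure_induction with
  | mem x hx => exact hf x hx
  | zero => simp
  | add x y _ _ hx hy => rw [map_add]; exact add_nonneg hx hy

/-- Twice the `δ`-coordinate plus the coordinates of `ε_i, δ_i` for `i ≤ n`. -/
def partialHeight (n : ℕ) : V k →ₗ[ℚ] ℚ where
  toFun v := 2 * v.2.2.1 + ∑ i : Fin k, if (i : ℕ) ≤ n then v.1 i + v.2.1 i else 0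
  map_add' v w := by
    simp only [Prod.snd_add, Prod.fst_add, Pi.add_apply]
    rw [add_add_add_comm, ← Finset.sum_add_distrib, ← mul_add]
    congr 1
    refine Finset.sum_congr rfl fun i _ => ?_
    split_ifs <;> ring
  map_smul' c v := by
    simp [mul_add, Finset.mul_sum]
    ring

theorem sum_le_indicator {n m : ℕ} (hm : m < k) :
    (∑ i : Fin k, if (i : ℕ) ≤ n then (if (i : ℕ) = m then (1 : ℚ) else 0) else 0) =
      if m ≤ n then 1 else 0 := by
  rw [Finset.sum_eq_single (⟨m, hm⟩ : Fin k)]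
  · simp
  · intro i _ hi
    have : (i : ℕ) ≠ m := fun h => hi (Fin.ext h)
    simp [this]
  · simp

theorem partialHeight_epsN (n : ℕ) {m : ℕ} (hm : m < k) :
    partialHeight n (epsN k m) = if m ≤ n then 1 else 0 := by
  simpa [partialHeight, epsN] using sum_le_indicator hm

theorem partialHeight_dlN (n : ℕ) {m : ℕ} (hm : m < k) :
    partialHeight n (dlN k m) = if m ≤ n then 1 else 0 := by
  simpa [partialHeight, dlN] using sum_le_indicator hm

theorem partialHeight_dd (n : ℕ) : partialHeight n (dd k) = 2 := by
  simp [partialHeight, dd]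

theorem partialHeight_nonneg (hk : 1 ≤ k) (n : ℕ) {v : V k} (hv : v ∈ Qp k) :
    0 ≤ partialHeight n v := by
  refine Qp_nonneg ?_ hv
  rintro v (((rfl | ⟨m, hm, rfl⟩) | ⟨m, hm, rfl⟩) | rfl)
  · rw [map_sub, map_sub, partialHeight_dd, partialHeight_epsN n (by omega),
      partialHeight_dlN n (by omega)]
    norm_num
  · rw [map_sub, partialHeight_epsN n (by omega), partialHeight_dlN n (by omega), sub_self]
  · rw [map_sub, partialHeight_epsN n (by omega), partialHeight_dlN n (by omega)]
    split_ifs <;> first | omega | norm_num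
  · rw [partialHeight_epsN n (by omega)]
    split_ifs <;> norm_num

theorem dd_coord_nonneg {v : V k} (hv : v ∈ Qp k) : 0 ≤ v.2.2.1 := by
  let f : V k →ₗ[ℚ] ℚ :=
    LinearMap.fst ℚ ℚ ℚ ∘ₗ LinearMap.snd ℚ (Fin k → ℚ) (ℚ × ℚ) ∘ₗ
      LinearMap.snd ℚ (Fin k → ℚ) ((Fin k → ℚ) × ℚ × ℚ)
  refine Qp_nonneg (f := f) ?_ hv
  rintro v (((rfl | ⟨m, hm, rfl⟩) | ⟨m, hm, rfl⟩) | rfl) <;>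
    simp [f, dd, epsN, dlN]

theorem sum_smul_epsN (c : Fin k → ℚ) : ∑ i, c i • epsN k i = (c, 0, 0, 0) := by
  refine Prod.ext ?_ (Prod.ext ?_ (Prod.ext ?_ ?_))
  · ext j
    simp [epsN, Prod.fst_sum, Finset.sum_apply, Fin.val_inj]
  all_goals simp [epsN, Prod.snd_sum]

theorem sum_smul_dlN (c : Fin k → ℚ) : ∑ g, c g • dlN k g = (0, c, 0, 0) := by
  refine Prod.ext ?_ (Prod.ext ?_ (Prod.ext ?_ ?_))
  · simp [dlN, Prod.fst_sum]
  · ext j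
    simp [dlN, Prod.fst_sum, Prod.snd_sum, Finset.sum_apply, Fin.val_inj]
  all_goals simp [dlN, Prod.snd_sum]

theorem eq_sum_basis (v : V k) :
    v = ∑ i, v.1 i • epsN k i + ∑ g, v.2.1 g • dlN k g + v.2.2.1 • dd k + v.2.2.2 • lam k := by
  rw [sum_smul_epsN, sum_smul_dlN]
  simp [dd, lam]

theorem rho_eq : rho k = (fun _ => 2⁻¹, fun _ => -2⁻¹, 0, 1) := by
  have hε := sum_smul_epsN (k := k) fun _ => 1
  have hδ := sum_smul_dlN (k := k) fun _ => 1
  simp only [one_smul] at hε hδ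
  rw [rho, hε, hδ]
  refine Prod.ext ?_ (Prod.ext ?_ (Prod.ext ?_ ?_)) <;> first | (ext; simp [lam]) | simp [lam]

/-- A permutation of `Fin k` which nowhere decreases is the identity. -/
theorem perm_eq_self_of_le {σ : Equiv.Perm (Fin k)} (h : ∀ i, i ≤ σ i) (i : Fin k) : σ i = i := by
  have hs : ∑ j : Fin k, (j : ℕ) = ∑ j : Fin k, (σ j : ℕ) :=
    (Equiv.sum_comp σ fun j : Fin k => (j : ℕ)).symm
  exact (Fin.ext ((Finset.sum_eq_sum_iff_of_le fun (j : Fin k) _ => Fin.val_le_of_le (h j)).1 hs i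
    (Finset.mem_univ i))).symm

theorem apply_eq_of_signed_perm {y : V k ≃ₗ[ℚ] V k} {σ : Equiv.Perm (Fin k)} {s : Fin k → ℚ}
    (hyε : ∀ i : Fin k, y (epsN k i) = s i • epsN k (σ i))
    (hyδ : ∀ g : Fin k, y (dlN k g) = dlN k g)
    (hyd : y (dd k) = dd k) (hyl : y (lam k) = lam k) (v : V k) :
    y v = (fun j => v.1 (σ.symm j) * s (σ.symm j), v.2) := by
  have hsum : ∑ i, v.1 i • s i • epsN k (σ i) =
      ∑ j, (v.1 (σ.symm j) * s (σ.symm j)) • epsN k j := by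
    rw [← Equiv.sum_comp σ fun j => (v.1 (σ.symm j) * s (σ.symm j)) • epsN k j]
    simp [mul_smul]
  conv_lhs => rw [eq_sum_basis v]
  simp only [map_add, map_sum, map_smul, hyε, hyδ, hyd, hyl]
  rw [hsum, sum_smul_epsN, sum_smul_dlN]
  simp [dd, lam]

end Helpers

/-- **Triviality of the stabilizing set `A`, case `A(2k,2k−1)^(2)`.**
Suppose `w = t_μ∘y` with `μ ∈ ℤε₁+⋯+ℤε_k` and `y ∈ W′` a signed permutation of
`ε₁,…,ε_k` fixing `δ₁,…,δ_k, δ, Λ₀`.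
If `w(ρ̂) = ρ̂` and `w(δ_i−ε_i) ∈ Δ̂⁺` for every `i = 1,…,k`, then `μ = 0`
and `y` is the identity. -/
theorem stabilizer_trivial_A_2k_2km1 (hk : 1 ≤ k)
    (a : Fin k → ℤ)
    (μ : V k) (hμ : μ = ∑ i : Fin k, (a i : ℚ) • epsN k i)
    (y : V k ≃ₗ[ℚ] V k) (σ : Equiv.Perm (Fin k))
    (hyε : ∀ i : Fin k, y (epsN k i) = epsN k (σ i) ∨ y (epsN k i) = -epsN k (σ i))
    (hyδ : ∀ g : Fin k, y (dlN k g) = dlN k g)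
    (hyd : y (dd k) = dd k) (hyl : y (lam k) = lam k)
    (hwρ : tmap k μ (y (rho k)) = rho k)
    (hwS : ∀ m : ℕ, m + 1 ≤ k →
      tmap k μ (y (dlN k m - epsN k m)) ∈ DeltaHatPos k) :
    μ = 0 ∧ ∀ v : V k, y v = v := by
  have hsign : ∀ i : Fin k, ∃ c : ℚ, (c = 1 ∨ c = -1) ∧ y (epsN k i) = c • epsN k (σ i) := by
    intro i
    rcases hyε i with h | h
    · exact ⟨1, .inl rfl, by simpa using h⟩
    · exact ⟨-1, .inr rfl, by simpa using h⟩
  choose s hs hys using hsign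
  have hy := apply_eq_of_signed_perm hys hyδ hyd hyl
  have hμ' : μ = (fun i => (a i : ℚ), 0, 0, 0) := by rw [hμ, sum_smul_epsN]
  have ha : ∀ j, 2⁻¹ * s (σ.symm j) + a j = 2⁻¹ := by
    intro j
    have := congrFun (congrArg Prod.fst hwρ) j
    rw [hy, rho_eq, hμ'] at this
    simpa [tmap, form, dd] using this
  have hw : ∀ i : Fin k, tmap k μ (y (dlN k i - epsN k i)) =
      dlN k i - s i • epsN k (σ i) + (s i * a (σ i)) • dd k := by
    intro i
    rw [map_sub, hyδ, hys, hμ']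
    simp [tmap, form, dd, dlN, epsN, Fin.val_inj]
  have hmem : ∀ i : Fin k, dlN k i - s i • epsN k (σ i) + (s i * a (σ i)) • dd k ∈ Qp k :=
    fun i => hw i ▸ (hwS i i.2).2.1
  have hs1 : ∀ i, s i = 1 := by
    intro i
    refine (hs i).resolve_right fun h => ?_
    have h1 := ha (σ i)
    have h2 := dd_coord_nonneg (hmem i)
    simp only [Equiv.symm_apply_apply, h] at h1
    have h3 : (a (σ i) : ℚ) = 1 := by linarith
    simp [h, h3, dd, dlN, epsN] at h2
    linarith
  have ha0 : ∀ j, (a j : ℚ) = 0 := by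
    intro j
    have := ha j
    rw [hs1] at this
    linarith
  have hσ : ∀ i, σ i = i := by
    refine perm_eq_self_of_le fun i => ?_
    by_contra! hlt
    have h := partialHeight_nonneg hk (σ i : ℕ) (hmem i)
    rw [hs1, ha0, mul_zero, zero_smul, add_zero, one_smul, map_sub,
      partialHeight_epsN _ (σ i).2, partialHeight_dlN _ i.2, if_pos le_rfl,
      if_neg (by simpa using hlt)] at h
    norm_num at h
  refine ⟨by rw [hμ']; simp only [ha0]; rfl, fun v => ?_⟩
  have hσ' : ∀ j, σ.symm j = j := fun j => by rw [Equiv.symm_apply_eq, hσ]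
  rw [hy]
  simp [hs1, hσ']

end Stmt11
end
end

section
/- (Key estimate for local finiteness, case A(2k−1,2k−1)^(2).) Let μ = n₁δ₁+⋯+n_kδ_k with n_i ∈ ℤ, and set v(μ) := Σ_{α∈Δ₀⁺ with (α,μ)>0} α − Σ_{β∈Δ₁⁺ with (β,μ)>0} β. Write v(μ) = a₁δ₁+⋯+a_kδ_k + w with w in the span of ε₁,…,ε_k. Then for every i: if n_i > 0 then a_i ≤ −1, and if n_i < 0 then a_i ≥ 1. Consequently (v(μ),μ) = Σ_i a_i n_i ≤ −Σ_i |n_i| ≤ 0, and (v(μ),μ) = 0 only if μ = 0. -/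
/-!
Key estimate for local finiteness, case `A(2k−1,2k−1)^(2)`: for
`μ = n₁δ₁+⋯+n_kδ_k` and
`v(μ) := Σ_{α∈Δ₀⁺, (α,μ)>0} α − Σ_{β∈Δ₁⁺, (β,μ)>0} β`, written as
`v(μ) = Σ a_i δ_i + w` with `w` in the span of the `ε`'s, one has `a_i ≤ −1`
whenever `n_i > 0` and `a_i ≥ 1` whenever `n_i < 0`; consequently
`(v(μ),μ) = Σ a_i n_i ≤ −Σ|n_i| ≤ 0`, with equality to `0` only for `μ = 0`.

Here `Δ₀⁺, Δ₁⁺` are the positive even/odd roots of `D(k,k)`, the finite part of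
`A(2k−1,2k−1)^(2)`.
-/

open scoped BigOperators Classical

noncomputable section

namespace Stmt12

variable (k : ℕ)

/-- The space `V₀` with basis `ε₁,…,ε_k, δ₁,…,δ_k`
(first component: `ε`-coordinates, second component: `δ`-coordinates). -/
abbrev V0 : Type := (Fin k → ℚ) × (Fin k → ℚ)

/-- `ε_i`. -/
def eps (i : Fin k) : V0 k := (Pi.single i 1, 0)

/-- `δ_g`. -/
def dl (g : Fin k) : V0 k := (0, Pi.single g 1)

/-- The bilinear form: `(ε_i,ε_j) = −δ_{ij}`, `(δ_g,δ_h) = δ_{gh}`, `(ε_i,δ_g)=0`. -/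
def form (x y : V0 k) : ℚ := -(∑ i, x.1 i * y.1 i) + ∑ g, x.2 g * y.2 g

/-- sign attached to a boolean -/
def sg (b : Bool) : ℚ := cond b 1 (-1)

/-- `μ = n₁δ₁ + ⋯ + n_kδ_k`. -/
def muv (n : Fin k → ℤ) : V0 k := ∑ g, (n g : ℚ) • dl k g

/-- `v(μ) = Σ_{α∈Δ₀⁺, (α,μ)>0} α − Σ_{β∈Δ₁⁺, (β,μ)>0} β`, where
`Δ₀⁺ = {δ_i±δ_j, ε_i±ε_j : i<j} ∪ {2ε_i}` and
`Δ₁⁺ = {δ_i±ε_j : i<j} ∪ {ε_i±δ_j : i≤j}` are the positive even and odd roots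
of `D(k,k)`. -/
def v (n : Fin k → ℤ) : V0 k :=
  (∑ x : Bool × Fin k × Fin k,
      if (x.2.1 : ℕ) < (x.2.2 : ℕ) ∧
          0 < form k (dl k x.2.1 + sg x.1 • dl k x.2.2) (muv k n) then
        dl k x.2.1 + sg x.1 • dl k x.2.2 else 0) +
  (∑ x : Bool × Fin k × Fin k,
      if (x.2.1 : ℕ) < (x.2.2 : ℕ) ∧
          0 < form k (eps k x.2.1 + sg x.1 • eps k x.2.2) (muv k n) then
        eps k x.2.1 + sg x.1 • eps k x.2.2 else 0) +
  (∑ i : Fin k,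
      if 0 < form k ((2 : ℚ) • eps k i) (muv k n) then (2 : ℚ) • eps k i else 0) -
  (∑ x : Bool × Fin k × Fin k,
      if (x.2.1 : ℕ) < (x.2.2 : ℕ) ∧
          0 < form k (dl k x.2.1 + sg x.1 • eps k x.2.2) (muv k n) then
        dl k x.2.1 + sg x.1 • eps k x.2.2 else 0) -
  (∑ x : Bool × Fin k × Fin k,
      if (x.2.1 : ℕ) ≤ (x.2.2 : ℕ) ∧
          0 < form k (eps k x.2.1 + sg x.1 • dl k x.2.2) (muv k n) then
        eps k x.2.1 + sg x.1 • dl k x.2.2 else 0)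

/-- The `δ`-coordinates of `μ` are the `n_g`, its `ε`-coordinates vanish. -/
lemma muv_eq (n : Fin k → ℤ) : muv k n = (0, fun g => (n g : ℚ)) := by
  ext g <;> simp [muv, dl, Prod.fst_sum, Prod.snd_sum, Pi.single_apply]

lemma form_muv (n : Fin k → ℤ) (x : V0 k) : form k x (muv k n) = ∑ g, x.2 g * (n g : ℚ) := by
  simp [form, muv_eq]

/-- A sum over ordered pairs weighted by the `l`-th coordinate of `e_i + c e_j` localizes
to the pairs containing `l`. -/
lemma sum_ite_pair (p : Fin k → Fin k → Prop) [∀ i j, Decidable (p i j)] (c : ℚ) (l : Fin k) :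
    (∑ i, ∑ j, if p i j then (if l = i then 1 else 0) + c * (if l = j then 1 else 0) else 0) =
      ∑ j, ((if p l j then 1 else 0) + if p j l then c else 0) := by
  have h : ∀ i j : Fin k,
      (if p i j then (if l = i then (1 : ℚ) else 0) + c * (if l = j then 1 else 0) else 0) =
        (if l = i then (if p i j then 1 else 0) else 0) +
          (if l = j then (if p i j then c else 0) else 0) := by
    intro i j
    split_ifs <;> simp
  simp only [h, Finset.sum_add_distrib]
  congr 1
  · rw [Finset.sum_comm]
    simp
  · simp

/-- The `δ_l`-coordinate of `v(μ)` as a single sum over the indices `j`. -/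
lemma v_snd (n : Fin k → ℤ) (l : Fin k) :
    (v k n).2 l = ∑ j : Fin k,
      ((if l < j ∧ 0 < n l + n j then 1 else 0) + (if j < l ∧ 0 < n j + n l then 1 else 0) +
        (if l < j ∧ 0 < n l - n j then 1 else 0) - (if j < l ∧ 0 < n j - n l then 1 else 0) -
        2 * (if l < j ∧ 0 < n l then 1 else 0) -
        (if j ≤ l ∧ 0 < n l then 1 else 0) + (if j ≤ l ∧ n l < 0 then (1 : ℚ) else 0)) := by
  have hd (i j : Fin k) (b : Bool) : form k (dl k i + sg b • dl k j) (muv k n) =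
      n i + sg b * n j := by
    simp [form_muv, dl, Pi.single_apply, add_mul, Finset.sum_add_distrib]
  have he (i j : Fin k) (b : Bool) : form k (eps k i + sg b • eps k j) (muv k n) = 0 := by
    simp [form_muv, eps]
  have hde (i j : Fin k) (b : Bool) : form k (dl k i + sg b • eps k j) (muv k n) = n i := by
    simp [form_muv, dl, eps, Pi.single_apply]
  have hed (i j : Fin k) (b : Bool) : form k (eps k i + sg b • dl k j) (muv k n) =
      sg b * n j := by
    simp [form_muv, dl, eps, Pi.single_apply]
  have hee (i : Fin k) : form k ((2 : ℚ) • eps k i) (muv k n) = 0 := by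
    simp [form_muv, eps]
  have hdd (b : Bool) := sum_ite_pair k (fun i j => i < j ∧ (0 : ℚ) < n i + sg b * n j) (sg b) l
  have hdd' (b : Bool) :
      (∑ i, ∑ j, (if i < j ∧ (0 : ℚ) < n i + sg b * n j then
        dl k i + sg b • dl k j else 0).2 l) =
      ∑ j, ((if l < j ∧ (0 : ℚ) < n l + sg b * n j then 1 else 0) +
        if j < l ∧ (0 : ℚ) < n j + sg b * n l then sg b else 0) := by
    rw [← hdd]
    refine Finset.sum_congr rfl fun i _ => Finset.sum_congr rfl fun j _ => ?_
    split_ifs <;> simp_all [dl]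
  have hde' (b : Bool) :
      (∑ i, ∑ j, (if i < j ∧ (0 : ℚ) < n i then dl k i + sg b • eps k j else 0).2 l) =
      ∑ j, if l < j ∧ (0 : ℚ) < n l then 1 else 0 := by
    rw [Finset.sum_comm]
    refine Finset.sum_congr rfl fun j _ => ?_
    rw [Finset.sum_eq_single l]
    · split_ifs <;> simp [dl, eps]
    · intro i _ hi
      split_ifs <;> simp [dl, eps, hi.symm]
    · simp
  have hed' (b : Bool) :
      (∑ i, ∑ j, (if i ≤ j ∧ (0 : ℚ) < sg b * n j then eps k i + sg b • dl k j else 0).2 l) =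
      ∑ j, if j ≤ l ∧ (0 : ℚ) < sg b * n l then sg b else 0 := by
    refine Finset.sum_congr rfl fun i _ => ?_
    rw [Finset.sum_eq_single l]
    · split_ifs <;> simp [dl, eps]
    · intro j _ hj
      split_ifs <;> simp [dl, eps, hj.symm]
    · simp
  simp only [v, hd, he, hde, hed, hee, Fin.val_fin_lt, Fin.val_fin_le, lt_irrefl, and_false,
    if_false, Finset.sum_const_zero, add_zero, Fintype.sum_prod_type, Fintype.sum_bool,
    Prod.snd_sub, Pi.sub_apply, Prod.snd_add, Pi.add_apply, Prod.snd_sum, Finset.sum_apply]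
  simp only [hdd', hde', hed']
  simp only [← Finset.sum_add_distrib, ← Finset.sum_sub_distrib]
  refine Finset.sum_congr rfl fun j _ => ?_
  have e1 : (0 : ℚ) < n l + n j ↔ 0 < n l + n j := by exact_mod_cast Iff.rfl
  have e2 : (0 : ℚ) < n j + n l ↔ 0 < n j + n l := by exact_mod_cast Iff.rfl
  have e3 : (0 : ℚ) < n l + -n j ↔ 0 < n l - n j := by
    rw [← sub_eq_add_neg]; exact_mod_cast Iff.rfl
  have e4 : (0 : ℚ) < n j + -n l ↔ 0 < n j - n l := by
    rw [← sub_eq_add_neg]; exact_mod_cast Iff.rfl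
  simp only [sg, cond_true, cond_false, one_mul, neg_mul, e1, e2, e3, e4, Int.cast_pos,
    Left.neg_pos_iff, Int.cast_lt_zero]
  have neg_ite (q : Prop) [Decidable q] : (if q then (-1 : ℚ) else 0) = -(if q then 1 else 0) := by
    split_ifs <;> simp
  simp only [neg_ite]
  ring

lemma v_snd_le_of_pos (n : Fin k → ℤ) (l : Fin k) (hl : 0 < n l) : (v k n).2 l ≤ -1 := by
  calc (v k n).2 l ≤ ∑ j : Fin k, (if j = l then (-1 : ℚ) else 0) := by
        rw [v_snd]
        refine Finset.sum_le_sum fun j _ => ?_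
        rcases lt_trichotomy j l with h | rfl | h
        · simp only [h, h.not_gt, h.le, h.ne, hl, hl.not_gt, true_and, false_and, and_true,
            if_true, if_false]
          split_ifs <;> norm_num
        · simp [hl, hl.not_gt]
        · simp only [h, h.not_gt, h.not_ge, h.ne', hl, hl.not_gt, true_and, false_and, and_true,
            if_true, if_false]
          split_ifs <;> norm_num
    _ = -1 := by simp

lemma le_v_snd_of_neg (n : Fin k → ℤ) (l : Fin k) (hl : n l < 0) : 1 ≤ (v k n).2 l := by
  calc 1 = ∑ j : Fin k, (if j = l then (1 : ℚ) else 0) := by simp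
    _ ≤ (v k n).2 l := by
        rw [v_snd]
        refine Finset.sum_le_sum fun j _ => ?_
        rcases lt_trichotomy j l with h | rfl | h
        · simp only [h, h.not_gt, h.le, h.ne, hl, hl.not_gt, true_and, false_and, and_true,
            and_false, if_true, if_false]
          split_ifs <;> norm_num
        · simp [hl, hl.not_gt]
        · simp only [h, h.not_gt, h.not_ge, h.ne', hl, hl.not_gt, true_and, false_and, and_true,
            and_false, if_false]
          split_ifs <;> norm_num

/-- **Key estimate for local finiteness, case `A(2k−1,2k−1)^(2)`.**
Writing `v(μ) = Σ a_i δ_i + w` with `w` in the span of the `ε`'s (so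
`a_i = (v μ).2 i`): if `n_i > 0` then `a_i ≤ −1`, if `n_i < 0` then `a_i ≥ 1`;
consequently `(v(μ),μ) = Σ_i a_i n_i ≤ −Σ_i |n_i| ≤ 0`, and `(v(μ),μ) = 0`
only if `μ = 0`. -/
theorem key_estimate_local_finiteness (hk : 1 ≤ k) (n : Fin k → ℤ) :
    (∀ i : Fin k, (0 < n i → (v k n).2 i ≤ -1) ∧ (n i < 0 → 1 ≤ (v k n).2 i)) ∧
    form k (v k n) (muv k n) = (∑ i, (v k n).2 i * (n i : ℚ)) ∧
    form k (v k n) (muv k n) ≤ -((∑ i, |n i| : ℤ) : ℚ) ∧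
    form k (v k n) (muv k n) ≤ 0 ∧
    (form k (v k n) (muv k n) = 0 → ∀ i, n i = 0) := by
  have hform := form_muv k n (v k n)
  have hle : form k (v k n) (muv k n) ≤ -((∑ i, |n i| : ℤ) : ℚ) := by
    rw [hform, Int.cast_sum, ← Finset.sum_neg_distrib]
    refine Finset.sum_le_sum fun i _ => ?_
    rcases lt_trichotomy (n i) 0 with h | h | h
    · have h' : (n i : ℚ) < 0 := by exact_mod_cast h
      rw [abs_of_neg h]
      push_cast
      nlinarith [le_v_snd_of_neg k n i h]
    · simp [h]
    · have h' : (0 : ℚ) < n i := by exact_mod_cast h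
      rw [abs_of_pos h]
      nlinarith [v_snd_le_of_pos k n i h]
  have hnonneg : 0 ≤ ∑ i, |n i| := Finset.sum_nonneg fun i _ => abs_nonneg (n i)
  have hnonneg' : (0 : ℚ) ≤ ((∑ i, |n i| : ℤ) : ℚ) := Int.cast_nonneg hnonneg
  refine ⟨fun i => ⟨v_snd_le_of_pos k n i, le_v_snd_of_neg k n i⟩, hform, hle, by linarith, ?_⟩
  intro h0 i
  have hsum : ((∑ i, |n i| : ℤ) : ℚ) = 0 := by linarith
  have hzero := (Finset.sum_eq_zero_iff_of_nonneg fun i _ => abs_nonneg (n i)).mp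
    (Int.cast_eq_zero.mp hsum) i (Finset.mem_univ i)
  exact abs_eq_zero.mp hzero

end Stmt12
end
end

section
/- (Evaluation lemma for the translated finite denominator of B(k,k).) For μ ∈ 2ℤδ₁+⋯+2ℤδ_k define the rational function F_μ(x,q) := q^{(ρ,μ)} · ∏_{α∈Δ₀⁺}(1 − x^{ht α} q^{−(α,μ)}) / ∏_{β∈Δ₁⁺}(1 − x^{ht β} q^{−(β,μ)}) ∈ ℚ(q)(x). Then: (i) F₀ has a pole at x = 1 of order exactly k (as a rational function of x over ℚ(q)); (ii) if μ ≠ 0, then the order of the pole of F_μ at x = 1 is at most #{i : (μ,δ_i) = 0} ≤ k−1; consequently the rational function F_μ/F₀ vanishes at x = 1 for every μ ≠ 0. -/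
/-!
Evaluation lemma for the translated finite denominator of `B(k,k)`:
for `μ ∈ 2ℤδ₁+⋯+2ℤδ_k` the rational function
`F_μ(x,q) := q^{(ρ,μ)} · ∏_{α∈Δ₀⁺}(1 − x^{ht α} q^{−(α,μ)}) /
∏_{β∈Δ₁⁺}(1 − x^{ht β} q^{−(β,μ)}) ∈ ℚ(q)(x)`
has, at `x = 1`, a pole of order exactly `k` when `μ = 0`, and a pole of order
at most `#{i : (μ,δ_i)=0} ≤ k−1` when `μ ≠ 0`; consequently `F_μ/F₀` vanishes
at `x = 1` for every `μ ≠ 0`.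

Weights are encoded in the integral root lattice
`L = (ε-coordinates) × (δ-coordinates)`, with `(ε_i,ε_j)=−δ_ij`,
`(δ_g,δ_h)=δ_gh`, `(ε_i,δ_g)=0`.  The height `ht` is the additive functional
taking the value `1` on every simple root of
`π = {ε₁−δ₁, δ₁−ε₂, ε₂−δ₂, …, ε_k−δ_k, δ_k}`.
-/

open scoped BigOperators Classical
open Polynomial

noncomputable section

namespace Stmt13

variable (k : ℕ)

/-- the root lattice of `B(k,k)` (ε-coordinates, δ-coordinates). -/
abbrev L : Type := (Fin k → ℤ) × (Fin k → ℤ)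

/-- `ε_{m+1}` (0-indexed: `epsZ m`). -/
def epsZ (m : ℕ) : L k := (fun i => if (i : ℕ) = m then 1 else 0, 0)

/-- `δ_{m+1}` (0-indexed: `dlZ m`). -/
def dlZ (m : ℕ) : L k := (0, fun g => if (g : ℕ) = m then 1 else 0)

/-- The bilinear form: `(ε_i,ε_j)=−δ_{ij}`, `(δ_g,δ_h)=δ_{gh}`, `(ε_i,δ_g)=0`. -/
def formZ (x y : L k) : ℤ := -(∑ i, x.1 i * y.1 i) + ∑ g, x.2 g * y.2 g

/-- integral sign attached to a boolean -/
def sgZ (b : Bool) : ℤ := cond b 1 (-1)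

/-- The simple roots `π = {ε₁−δ₁, δ₁−ε₂, ε₂−δ₂, …, ε_k−δ_k, δ_k}` of `B(k,k)`. -/
def piZ : Set (L k) :=
  {v | ∃ m : ℕ, m + 1 ≤ k ∧ v = epsZ k m - dlZ k m} ∪
  {v | ∃ m : ℕ, m + 2 ≤ k ∧ v = dlZ k m - epsZ k (m + 1)} ∪
  {v | v = dlZ k (k - 1)}

/-- Index for the multiset of positive roots of `B(k,k)`:
even `ε_i±ε_j (i<j)`, `2ε_i`, `δ_g±δ_h (g<h)`, `δ_g`;
odd `ε_i`, `ε_i+δ_g` (all `i,g`), `ε_i−δ_g (i≤g)`, `δ_g−ε_i (g<i)`. -/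
abbrev FIdx : Type :=
  (Bool × Fin k × Fin k) ⊕ (Fin k) ⊕ (Bool × Fin k × Fin k) ⊕ (Fin k) ⊕
  ((Fin k) ⊕ (Fin k × Fin k) ⊕ (Fin k × Fin k) ⊕ (Fin k × Fin k))

def froot : FIdx k → L k
  | Sum.inl (b, i, j) => epsZ k i + sgZ b • epsZ k j
  | Sum.inr (Sum.inl i) => (2 : ℤ) • epsZ k i
  | Sum.inr (Sum.inr (Sum.inl (b, g, h))) => dlZ k g + sgZ b • dlZ k h
  | Sum.inr (Sum.inr (Sum.inr (Sum.inl g))) => dlZ k g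
  | Sum.inr (Sum.inr (Sum.inr (Sum.inr (Sum.inl i)))) => epsZ k i
  | Sum.inr (Sum.inr (Sum.inr (Sum.inr (Sum.inr (Sum.inl (i, g)))))) => epsZ k i + dlZ k g
  | Sum.inr (Sum.inr (Sum.inr (Sum.inr (Sum.inr (Sum.inr (Sum.inl (i, g))))))) =>
      epsZ k i - dlZ k g
  | Sum.inr (Sum.inr (Sum.inr (Sum.inr (Sum.inr (Sum.inr (Sum.inr (g, i))))))) =>
      dlZ k g - epsZ k i

def fvalid : FIdx k → Prop
  | Sum.inl (_, i, j) => (i : ℕ) < (j : ℕ)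
  | Sum.inr (Sum.inr (Sum.inl (_, g, h))) => (g : ℕ) < (h : ℕ)
  | Sum.inr (Sum.inr (Sum.inr (Sum.inr (Sum.inr (Sum.inr (Sum.inl (i, g))))))) =>
      (i : ℕ) ≤ (g : ℕ)
  | Sum.inr (Sum.inr (Sum.inr (Sum.inr (Sum.inr (Sum.inr (Sum.inr (g, i))))))) =>
      (g : ℕ) < (i : ℕ)
  | _ => True

def fodd : FIdx k → Bool
  | Sum.inr (Sum.inr (Sum.inr (Sum.inr _))) => true
  | _ => false

/-- the field `ℚ(q)` -/
abbrev K : Type := RatFunc ℚ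

/-- the field `ℚ(q)(x)` -/
abbrev RF : Type := RatFunc (K)

/-- the variable `x` of `ℚ(q)(x)`. -/
def x : RF := RatFunc.X

/-- the variable `q`, viewed as a constant of `ℚ(q)(x)`. -/
def q : RF := RatFunc.C (RatFunc.X : K)

/-- `μ = 2m₁δ₁+⋯+2m_kδ_k ∈ 2ℤδ₁+⋯+2ℤδ_k`. -/
def muZ (m : Fin k → ℤ) : L k := ∑ g, (2 * m g) • dlZ k g

/-- `(ρ,μ)` for `ρ = (1/2)Σ(δ_i−ε_i)`, computed as `(2ρ, μ/2)`;
this is an integer for `μ ∈ 2ℤδ₁+⋯+2ℤδ_k`. -/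
def rhoPair (m : Fin k → ℤ) : ℤ :=
  formZ k (∑ i : Fin k, (dlZ k i - epsZ k i)) (∑ g : Fin k, m g • dlZ k g)

/-- `F_μ(x,q) := q^{(ρ,μ)} · ∏_{α∈Δ₀⁺}(1 − x^{ht α} q^{−(α,μ)}) /
∏_{β∈Δ₁⁺}(1 − x^{ht β} q^{−(β,μ)}) ∈ ℚ(q)(x)`,
where `ht` is the height functional. -/
def F (ht : L k →+ ℤ) (m : Fin k → ℤ) : RF :=
  q ^ rhoPair k m *
    (∏ y : FIdx k,
      if fvalid k y ∧ fodd k y = false then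
        1 - x ^ ht (froot k y) * q ^ (-(formZ k (froot k y) (muZ k m))) else 1) /
    (∏ y : FIdx k,
      if fvalid k y ∧ fodd k y = true then
        1 - x ^ ht (froot k y) * q ^ (-(formZ k (froot k y) (muZ k m))) else 1)

/-- `G ∈ ℚ(q)(x)` has a pole at `x = 1` of order at most `n`. -/
def PoleOrderLE (n : ℕ) (G : RF) : Prop :=
  ∃ p r : Polynomial K, Polynomial.eval 1 r ≠ 0 ∧
    G = algebraMap (Polynomial K) RF p / algebraMap (Polynomial K) RF r /
      (x - 1) ^ n

/-- `G ∈ ℚ(q)(x)` has a pole at `x = 1` of order exactly `n`. -/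
def PoleOrderExact (n : ℕ) (G : RF) : Prop :=
  ∃ p r : Polynomial K, Polynomial.eval 1 r ≠ 0 ∧ Polynomial.eval 1 p ≠ 0 ∧
    G = algebraMap (Polynomial K) RF p / algebraMap (Polynomial K) RF r /
      (x - 1) ^ n

/-- `G ∈ ℚ(q)(x)` is defined and vanishes at `x = 1`. -/
def VanishesAtOne (G : RF) : Prop :=
  ∃ p r : Polynomial K, Polynomial.eval 1 r ≠ 0 ∧ Polynomial.eval 1 p = 0 ∧
    G = algebraMap (Polynomial K) RF p / algebraMap (Polynomial K) RF r

section Form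

theorem formZ_add_left (u v w : L k) : formZ k (u + v) w = formZ k u w + formZ k v w := by
  simp only [formZ, Prod.fst_add, Prod.snd_add, Pi.add_apply, add_mul, Finset.sum_add_distrib]
  ring

theorem formZ_smul_left (c : ℤ) (v w : L k) : formZ k (c • v) w = c * formZ k v w := by
  simp only [formZ, Prod.smul_fst, Prod.smul_snd, Pi.smul_apply, smul_eq_mul, mul_assoc,
    ← Finset.mul_sum]
  ring

theorem formZ_sub_left (u v w : L k) : formZ k (u - v) w = formZ k u w - formZ k v w := by
  simp only [formZ, Prod.fst_sub, Prod.snd_sub, Pi.sub_apply, sub_mul, Finset.sum_sub_distrib]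
  ring

theorem formZ_comm (u v : L k) : formZ k u v = formZ k v u := by
  simp only [formZ, mul_comm]

theorem muZ_eq (m : Fin k → ℤ) : muZ k m = (0, fun g => 2 * m g) := by
  ext g <;> simp [muZ, dlZ, Prod.fst_sum, Prod.snd_sum, Finset.sum_apply, ← Fin.ext_iff]

theorem formZ_epsZ_muZ (m : Fin k → ℤ) (i : ℕ) : formZ k (epsZ k i) (muZ k m) = 0 := by
  simp [formZ, muZ_eq, epsZ]

theorem formZ_dlZ_muZ (m : Fin k → ℤ) (g : Fin k) :
    formZ k (dlZ k g) (muZ k m) = 2 * m g := by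
  simp [formZ, muZ_eq, dlZ, ← Fin.ext_iff]

end Form

section Height

variable {k} {ht : L k →+ ℤ}

theorem ht_epsZ_eq_ht_dlZ_add_one (hht : ∀ α ∈ piZ k, ht α = 1) {i : ℕ} (hi : i < k) :
    ht (epsZ k i) = ht (dlZ k i) + 1 := by
  have h := hht (epsZ k i - dlZ k i) (Or.inl (Or.inl ⟨i, hi, rfl⟩))
  rw [map_sub] at h
  omega

theorem ht_dlZ (hht : ∀ α ∈ piZ k, ht α = 1) {g : ℕ} (hg : g < k) :
    ht (dlZ k g) = 2 * (k - g) - 1 := by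
  obtain ⟨d, hd⟩ : ∃ d, k = g + d + 1 := ⟨k - g - 1, by omega⟩
  induction d generalizing g with
  | zero =>
    have h := hht (dlZ k (k - 1)) (Or.inr rfl)
    obtain rfl : g = k - 1 := by omega
    omega
  | succ d ih =>
    have h := hht (dlZ k g - epsZ k (g + 1)) (Or.inl (Or.inr ⟨g, by omega, rfl⟩))
    have h' := ht_epsZ_eq_ht_dlZ_add_one hht (i := g + 1) (by omega)
    have ih := ih (g := g + 1) (by omega) (by omega)
    rw [map_sub] at h
    push_cast at ih
    omega

theorem ht_epsZ (hht : ∀ α ∈ piZ k, ht α = 1) {i : ℕ} (hi : i < k) :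
    ht (epsZ k i) = 2 * (k - i) := by
  rw [ht_epsZ_eq_ht_dlZ_add_one hht hi, ht_dlZ hht hi]
  ring

theorem ht_froot_pos (hht : ∀ α ∈ piZ k, ht α = 1) {y : FIdx k} (hy : fvalid k y) :
    0 < ht (froot k y) := by
  have hε (i : Fin k) := ht_epsZ hht i.isLt
  have hδ (g : Fin k) := ht_dlZ hht g.isLt
  rcases y with ⟨b, i, j⟩ | i | ⟨b, g, h⟩ | g | i | ⟨i, g⟩ | ⟨i, g⟩ | ⟨g, i⟩ <;>
    simp only [froot, fvalid, map_add, map_sub, map_zsmul, smul_eq_mul, hε, hδ] at hy ⊢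
  · cases b <;> simp only [sgZ, cond] <;> omega
  · omega
  · cases b <;> simp only [sgZ, cond] <;> omega
  all_goals omega

end Height

section Order

/-- `G ∈ ℚ(q)(x)` has order of vanishing exactly `n` at `x = 1`. -/
def HasOrderAtOne (n : ℤ) (G : RF) : Prop :=
  ∃ p r : Polynomial K, Polynomial.eval 1 p ≠ 0 ∧ Polynomial.eval 1 r ≠ 0 ∧
    G = algebraMap (Polynomial K) RF p / algebraMap (Polynomial K) RF r * (x - 1) ^ n

theorem x_sub_one_eq : x - 1 = algebraMap (Polynomial K) RF (X - 1) := by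
  simp [x]

theorem x_sub_one_ne_zero : x - 1 ≠ 0 := by
  rw [x_sub_one_eq, map_ne_zero_iff _ (RatFunc.algebraMap_injective K)]
  exact X_sub_C_ne_zero 1

theorem algebraMap_ne_zero_of_eval_ne_zero {p : Polynomial K} (hp : Polynomial.eval 1 p ≠ 0) :
    algebraMap (Polynomial K) RF p ≠ 0 := by
  rw [map_ne_zero_iff _ (RatFunc.algebraMap_injective K)]
  rintro rfl
  simp at hp

theorem HasOrderAtOne.mul {a b : ℤ} {G H : RF} (hG : HasOrderAtOne a G)
    (hH : HasOrderAtOne b H) : HasOrderAtOne (a + b) (G * H) := by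
  obtain ⟨p, r, hp, hr, rfl⟩ := hG
  obtain ⟨p', r', hp', hr', rfl⟩ := hH
  refine ⟨p * p', r * r', by simp [hp, hp'], by simp [hr, hr'], ?_⟩
  rw [zpow_add₀ x_sub_one_ne_zero, map_mul, map_mul]
  ring

theorem HasOrderAtOne.inv {a : ℤ} {G : RF} (hG : HasOrderAtOne a G) :
    HasOrderAtOne (-a) G⁻¹ := by
  obtain ⟨p, r, hp, hr, rfl⟩ := hG
  refine ⟨r, p, hr, hp, ?_⟩
  rw [mul_inv, inv_div, zpow_neg]

theorem HasOrderAtOne.div {a b : ℤ} {G H : RF} (hG : HasOrderAtOne a G)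
    (hH : HasOrderAtOne b H) : HasOrderAtOne (a - b) (G / H) := by
  rw [div_eq_mul_inv, sub_eq_add_neg]
  exact hG.mul hH.inv

theorem hasOrderAtOne_algebraMap {p : Polynomial K} (hp : Polynomial.eval 1 p ≠ 0) :
    HasOrderAtOne 0 (algebraMap (Polynomial K) RF p) :=
  ⟨p, 1, hp, by simp, by simp⟩

theorem hasOrderAtOne_one : HasOrderAtOne 0 1 := by
  simpa using hasOrderAtOne_algebraMap (p := 1) (by simp)

theorem hasOrderAtOne_prod {ι : Type*} (s : Finset ι) {a : ι → ℤ} {G : ι → RF}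
    (h : ∀ i ∈ s, HasOrderAtOne (a i) (G i)) :
    HasOrderAtOne (∑ i ∈ s, a i) (∏ i ∈ s, G i) := by
  induction s using Finset.cons_induction with
  | empty => simpa using hasOrderAtOne_one
  | cons i s hi ih =>
    rw [Finset.sum_cons, Finset.prod_cons]
    exact (h i (by simp)).mul (ih fun j hj => h j (by simp [hj]))

theorem q_zpow_eq (e : ℤ) :
    q ^ e = algebraMap (Polynomial K) RF (C ((RatFunc.X : K) ^ e)) := by
  rw [RatFunc.algebraMap_C, map_zpow₀, q]

theorem hasOrderAtOne_q_zpow (e : ℤ) : HasOrderAtOne 0 (q ^ e) := by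
  rw [q_zpow_eq]
  exact hasOrderAtOne_algebraMap (by simpa using zpow_ne_zero e RatFunc.X_ne_zero)

theorem ratFunc_X_zpow_ne_one {e : ℤ} (he : e ≠ 0) : (RatFunc.X : K) ^ e ≠ 1 := by
  have key (n : ℕ) (hn : n ≠ 0) : (RatFunc.X : K) ^ n ≠ 1 := by
    rw [← RatFunc.algebraMap_X, ← map_pow, ← map_one (algebraMap ℚ[X] K),
      (RatFunc.algebraMap_injective ℚ).ne_iff]
    intro h
    simpa [hn] using congrArg (Polynomial.eval 0) h
  obtain ⟨n, rfl | rfl⟩ := e.eq_nat_or_neg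
  · simpa using key n (by simpa using he)
  · simpa using key n (by simpa using he)

theorem hasOrderAtOne_factor {h : ℤ} (hh : 0 < h) (e : ℤ) :
    HasOrderAtOne (if e = 0 then 1 else 0) (1 - x ^ h * q ^ (-e)) := by
  lift h to ℕ using hh.le
  rw [zpow_natCast]
  split_ifs with he
  · subst he
    refine ⟨-∑ i ∈ Finset.range h, X ^ i, 1, ?_, by simp, ?_⟩
    · simp only [eval_neg, eval_finsetSum, eval_pow, eval_X, one_pow, Finset.sum_const,
        Finset.card_range, nsmul_eq_mul, mul_one, neg_ne_zero]
      exact_mod_cast hh.ne'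
    · have := geom_sum_mul x h
      simp only [map_neg, map_sum, map_pow, RatFunc.algebraMap_X, map_one, div_one, neg_zero,
        zpow_zero, zpow_one, mul_one]
      change _ = -(∑ i ∈ Finset.range h, x ^ i) * _
      rw [neg_mul, this]
      ring
  · have : 1 - x ^ h * q ^ (-e) =
        algebraMap (Polynomial K) RF (1 - X ^ h * C ((RatFunc.X : K) ^ (-e))) := by
      rw [q_zpow_eq, map_sub, map_mul, map_one, map_pow, RatFunc.algebraMap_X, x]
    rw [this]
    refine hasOrderAtOne_algebraMap ?_
    simpa [sub_eq_zero] using (ratFunc_X_zpow_ne_one (neg_ne_zero.2 he)).symm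

theorem HasOrderAtOne.poleOrderExact {n : ℕ} {G : RF} (hG : HasOrderAtOne (-n) G) :
    PoleOrderExact n G := by
  obtain ⟨p, r, hp, hr, rfl⟩ := hG
  exact ⟨p, r, hr, hp, by rw [zpow_neg, zpow_natCast, ← div_eq_mul_inv]⟩

theorem HasOrderAtOne.poleOrderLE {a : ℤ} {n : ℕ} {G : RF} (hG : HasOrderAtOne a G)
    (h : -a ≤ n) : PoleOrderLE n G := by
  obtain ⟨p, r, hp, hr, rfl⟩ := hG
  obtain ⟨d, hd⟩ := Int.eq_ofNat_of_zero_le (show 0 ≤ a + n by omega)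
  obtain rfl : a = d - n := by omega
  refine ⟨p * (X - 1) ^ d, r, hr, ?_⟩
  rw [zpow_sub₀ x_sub_one_ne_zero, map_mul, map_pow, ← x_sub_one_eq, zpow_natCast, zpow_natCast]
  ring

theorem HasOrderAtOne.vanishesAtOne {a : ℤ} {G : RF} (hG : HasOrderAtOne a G) (ha : 0 < a) :
    VanishesAtOne G := by
  obtain ⟨p, r, hp, hr, rfl⟩ := hG
  lift a to ℕ using ha.le
  refine ⟨p * (X - 1) ^ a, r, hr, ?_, ?_⟩
  · simp [show a ≠ 0 by omega]
  · rw [map_mul, map_pow, ← x_sub_one_eq, zpow_natCast]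
    ring

end Order

section Count

theorem two_mul_sum_lt_of_symm (f : Fin k → Fin k → ℤ) (hf : ∀ i j, f i j = f j i) :
    2 * ∑ i, ∑ j, (if i < j then f i j else 0) = (∑ i, ∑ j, f i j) - ∑ i, f i i := by
  have hswap : ∑ i, ∑ j, (if i < j then f i j else 0) =
      ∑ i, ∑ j, (if j < i then f i j else 0) := by
    rw [Finset.sum_comm]
    simp only [hf]
  have hdiag : ∑ i, f i i = ∑ i, ∑ j, (if i = j then f i j else 0) := by simp
  have hsplit : ∑ i, ∑ j, f i j = ∑ i, ∑ j, ((if i < j then f i j else 0) +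
      (if j < i then f i j else 0) + (if i = j then f i j else 0)) := by
    refine Finset.sum_congr rfl fun i _ => Finset.sum_congr rfl fun j _ => ?_
    rcases lt_trichotomy i j with h | rfl | h
    · simp [h, h.not_gt, h.ne]
    · simp
    · simp [h, h.not_gt, h.ne']
  simp only [Finset.sum_add_distrib] at hsplit
  linarith

/-- The number of positive roots of parity `b` orthogonal to `μ`. -/
def orthCount (m : Fin k → ℤ) (b : Bool) : ℤ :=
  ∑ y : FIdx k, if fvalid k y ∧ fodd k y = b then
    (if formZ k (froot k y) (muZ k m) = 0 then 1 else 0) else 0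

theorem hasOrderAtOne_F {ht : L k →+ ℤ} (hht : ∀ α ∈ piZ k, ht α = 1) (m : Fin k → ℤ) :
    HasOrderAtOne (orthCount k m false - orthCount k m true) (F k ht m) := by
  have key (b : Bool) : HasOrderAtOne (orthCount k m b) (∏ y : FIdx k,
      if fvalid k y ∧ fodd k y = b then
        1 - x ^ ht (froot k y) * q ^ (-(formZ k (froot k y) (muZ k m))) else 1) := by
    refine hasOrderAtOne_prod _ fun y _ => ?_
    split_ifs with hy h0
    · simpa [h0] using hasOrderAtOne_factor (ht_froot_pos hht hy.1) 0
    · simpa [h0] using hasOrderAtOne_factor (ht_froot_pos hht hy.1)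
        (formZ k (froot k y) (muZ k m))
    · exact hasOrderAtOne_one
  rw [← zero_add (orthCount k m false)]
  exact ((hasOrderAtOne_q_zpow (rhoPair k m)).mul (key false)).div (key true)

variable {k}

/-- The number of vanishing coordinates of `μ`. -/
def zeroCount (m : Fin k → ℤ) : ℕ := (Finset.univ.filter fun g : Fin k => m g = 0).card

theorem zeroCount_eq_sum (m : Fin k → ℤ) :
    (zeroCount m : ℤ) = ∑ g, if m g = 0 then 1 else 0 := by
  simp [zeroCount]

theorem card_orthogonal_eq_zeroCount (m : Fin k → ℤ) :
    (Finset.univ.filter fun i : Fin k => formZ k (muZ k m) (dlZ k i) = 0).card =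
      zeroCount m := by
  simp [zeroCount, formZ_comm k (muZ k m), formZ_dlZ_muZ]

theorem zeroCount_zero : zeroCount (fun _ : Fin k => (0 : ℤ)) = k := by
  simp [zeroCount]

theorem zeroCount_lt {m : Fin k → ℤ} (hm : m ≠ 0) : zeroCount m < k := by
  obtain ⟨g, hg⟩ := Function.ne_iff.1 hm
  refine (Finset.card_lt_univ_of_notMem (x := g) ?_).trans_eq (Fintype.card_fin k)
  simpa using hg

theorem orthCount_odd (m : Fin k → ℤ) : orthCount k m true = k + 2 * k * zeroCount m := by
  have hmixed : (∑ i : Fin k, ∑ g : Fin k, if i ≤ g then (if m g = 0 then (1 : ℤ) else 0) else 0) +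
      (∑ g : Fin k, ∑ i : Fin k, if g < i then (if m g = 0 then 1 else 0) else 0) =
        k * zeroCount m := by
    rw [Finset.sum_comm, ← Finset.sum_add_distrib, zeroCount_eq_sum, Finset.mul_sum]
    refine Finset.sum_congr rfl fun g _ => ?_
    rw [← Finset.sum_add_distrib, Finset.sum_congr rfl (g := fun _ => if m g = 0 then 1 else 0)]
    · simp
    · intro i _
      rcases le_or_gt i g with h | h
      · simp [h, h.not_gt]
      · simp [h, h.not_ge]
  simp only [orthCount, Fintype.sum_sum_type, Fintype.sum_prod_type, froot, fvalid, fodd,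
    formZ_add_left, formZ_sub_left, formZ_epsZ_muZ, formZ_dlZ_muZ]
  rw [zeroCount] at hmixed ⊢
  simp [hmixed]
  ring

theorem orthCount_even (m : Fin k → ℤ) :
    orthCount k m false = k ^ 2 + zeroCount m +
      ∑ g, ∑ h, (if g < h then (if m g + m h = 0 then 1 else 0) +
        (if m g - m h = 0 then 1 else 0) else 0) := by
  have hε := two_mul_sum_lt_of_symm k (fun _ _ => 1) fun _ _ => rfl
  have hadd (a b : ℤ) : 2 * a + 2 * b = 0 ↔ a + b = 0 := by omega
  have hsub (a b : ℤ) : 2 * a + -(2 * b) = 0 ↔ a - b = 0 := by omega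
  have hδ : ∑ g, ∑ h, (if g < h then (if m g + m h = 0 then (1 : ℤ) else 0) +
        (if m g - m h = 0 then 1 else 0) else 0) =
      (∑ g, ∑ h, if g < h then (if m g + m h = 0 then 1 else 0) else 0) +
        ∑ g, ∑ h, if g < h then (if m g - m h = 0 then 1 else 0) else 0 := by
    simp only [← Finset.sum_add_distrib, ite_add_ite, add_zero]
  rw [hδ]
  simp only [Finset.sum_boole, Finset.sum_const, Finset.card_univ, Fintype.card_fin,
    nsmul_eq_mul, mul_one] at hε
  simp only [orthCount, Fintype.sum_sum_type, Fintype.sum_prod_type, froot, fvalid, fodd,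
    formZ_add_left, formZ_smul_left, formZ_epsZ_muZ, formZ_dlZ_muZ]
  simp [sgZ, zeroCount, hadd, hsub]
  linarith

theorem two_mul_sum_lt_zero_pairs (m : Fin k → ℤ) :
    ∑ g, ∑ h, (if g < h then
      (2 * ((if m g = 0 then 1 else 0) * if m h = 0 then 1 else 0) : ℤ) else 0) =
      (zeroCount m : ℤ) ^ 2 - zeroCount m := by
  have h := two_mul_sum_lt_of_symm k
    (fun g h => (if m g = 0 then 1 else 0) * if m h = 0 then 1 else 0) fun _ _ => mul_comm _ _
  have hdiag (g : Fin k) : ((if m g = 0 then 1 else 0) * if m g = 0 then 1 else 0 : ℤ) =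
      if m g = 0 then 1 else 0 := by
    split_ifs <;> rfl
  simp_rw [hdiag, ← Finset.mul_sum, ← Finset.sum_mul, ← zeroCount_eq_sum] at h
  rw [sq, ← h, Finset.mul_sum]
  simp_rw [Finset.mul_sum]
  refine Finset.sum_congr rfl fun g _ => Finset.sum_congr rfl fun h _ => ?_
  rw [mul_ite (g < h), mul_zero]

theorem sq_add_sq_le_orthCount_even (m : Fin k → ℤ) :
    (k : ℤ) ^ 2 + zeroCount m ^ 2 ≤ orthCount k m false := by
  have hle : ∑ g, ∑ h, (if g < h then
      (2 * ((if m g = 0 then 1 else 0) * if m h = 0 then 1 else 0) : ℤ) else 0) ≤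
      ∑ g, ∑ h, (if g < h then (if m g + m h = 0 then 1 else 0) +
        (if m g - m h = 0 then 1 else 0) else 0) := by
    refine Finset.sum_le_sum fun g _ => Finset.sum_le_sum fun h _ => ?_
    by_cases hg : m g = 0 <;> by_cases hh : m h = 0 <;> split_ifs <;> simp_all
  rw [two_mul_sum_lt_zero_pairs] at hle
  rw [orthCount_even]
  linarith

theorem orthCount_even_zero : orthCount k (fun _ => 0) false = 2 * (k : ℤ) ^ 2 := by
  have h := two_mul_sum_lt_zero_pairs fun _ : Fin k => (0 : ℤ)
  simp only [if_true, mul_one, zeroCount_zero] at h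
  rw [orthCount_even, zeroCount_zero]
  simp only [add_zero, sub_zero, if_true, one_add_one_eq_two, h]
  ring

end Count

/-- **Evaluation lemma for the translated finite denominator of `B(k,k)`.**
(i) `F₀` has a pole at `x = 1` of order exactly `k`;
(ii) if `μ ≠ 0`, then the pole of `F_μ` at `x = 1` has order at most
`#{i : (μ,δ_i) = 0} ≤ k−1`; consequently `F_μ/F₀` vanishes at `x = 1` for
every `μ ≠ 0`. -/
theorem evaluation_lemma_B_kk (hk : 1 ≤ k)
    (ht : L k →+ ℤ) (hht : ∀ α ∈ piZ k, ht α = 1) :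
    PoleOrderExact k (F k ht (fun _ => 0)) ∧
    (∀ m : Fin k → ℤ, m ≠ 0 →
      PoleOrderLE
        (Finset.univ.filter fun i : Fin k => formZ k (muZ k m) (dlZ k i) = 0).card
        (F k ht m) ∧
      (Finset.univ.filter fun i : Fin k => formZ k (muZ k m) (dlZ k i) = 0).card ≤ k - 1 ∧
      VanishesAtOne (F k ht m / F k ht (fun _ => 0))) := by
  have hF₀ : HasOrderAtOne (-k) (F k ht fun _ => 0) := by
    convert hasOrderAtOne_F k hht (fun _ => 0) using 1
    rw [orthCount_even_zero, orthCount_odd, zeroCount_zero]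
    ring
  refine ⟨hF₀.poleOrderExact, fun m hm => ?_⟩
  have hF := hasOrderAtOne_F k hht m
  have hlt := zeroCount_lt hm
  have hbound : -(zeroCount m : ℤ) ≤ orthCount k m false - orthCount k m true := by
    have := sq_add_sq_le_orthCount_even m
    have hlt' : (zeroCount m : ℤ) + 1 ≤ k := by exact_mod_cast hlt
    rw [orthCount_odd]
    nlinarith
  rw [card_orthogonal_eq_zeroCount]
  exact ⟨hF.poleOrderLE (by omega), by omega, (hF.div hF₀).vanishesAtOne (by omega)⟩

end Stmt13
end
end
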